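/- arXiv:2411.10767 — 2 statements merged into one kernel-verified Lean document; each statement's English description precedes it below -/
import Mathlib

section
/- Let A be a hereditary abelian category, t ≥ 1, and let A_1^• and A_2^• be t-periodic complexes over A with zero differentials. Then there is an isomorphism of abelian groups Ext^1_{C_t(A)}(A_1^•, A_2^•) ≅ Hom_{D_t(A)}(A_1^•, A_2^•[1]) between the extension group in the category C_t(A) of t-periodic complexes and the Hom group in the relative derived category D_t(A) into the shift of A_2^•. -/
/-!
STATEMENT 13.
Let `A` be a hereditary abelian category, `t ≥ 1`, and `A₁^•, A₂^•` `t`-periodic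
complexes with zero differentials.  Then there is an isomorphism of abelian groups
`Ext¹_{C_t(A)}(A₁^•, A₂^•) ≃+ Hom_{D_t(A)}(A₁^•, A₂^•[1])`,
where `D_t(A)` is encoded as any additive localization `L : C_t(A) ⥤ E` at the
quasi-isomorphisms, and `A₂^•[1]` is the degree shift of `A₂^•` (which, for a complex
with zero differentials and components `g`, has components `j ↦ g (j+1)`).
-/

open CategoryTheory CategoryTheory.Limits

noncomputable section

namespace GreenDH

def pShape (t : ℕ) : ComplexShape (ZMod t) := ComplexShape.up' (1 : ZMod t)

abbrev Ct (A : Type) [SmallCategory A] [Abelian A] (t : ℕ) :=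
  HomologicalComplex A (pShape t)

/-- The `t`-periodic complex with prescribed components and zero differentials. -/
def mkZero {A : Type} [SmallCategory A] [Abelian A] {t : ℕ} (f : ZMod t → A) : Ct A t where
  X := f
  d _ _ := 0
  shape _ _ _ := rfl
  d_comp_d' := by intros; simp

set_option linter.unusedSectionVars false

universe w v u
section ExtGeneral

open Abelian DerivedCategory Pretriangulated

section Tri

variable {D : Type u} [Category.{v} D] [HasZeroObject D] [HasShift D ℤ] [Preadditive D]
  [∀ n : ℤ, (shiftFunctor D n).Additive] [Pretriangulated D]
  {X Y Z T : D} {f : X ⟶ Y} {g : Y ⟶ Z} {h : Z ⟶ X⟦(1 : ℤ)⟧}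

lemma tri_zero (hT : Triangle.mk f g h ∈ distTriang D) : f ≫ g = 0 :=
  comp_distTriang_mor_zero₁₂ _ hT

lemma tri_co₁ (hT : Triangle.mk f g h ∈ distTriang D) (a : T ⟶ X⟦(1 : ℤ)⟧)
    (ha : a ≫ f⟦(1 : ℤ)⟧' = 0) : ∃ b : T ⟶ Z, a = b ≫ h :=
  Triangle.coyoneda_exact₁ _ hT a ha

lemma tri_co₂ (hT : Triangle.mk f g h ∈ distTriang D) (a : T ⟶ Y)
    (ha : a ≫ g = 0) : ∃ b : T ⟶ X, a = b ≫ f :=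
  Triangle.coyoneda_exact₂ _ hT a ha

lemma tri_yo₃ (hT : Triangle.mk f g h ∈ distTriang D) (a : Z ⟶ T)
    (ha : g ≫ a = 0) : ∃ b : X⟦(1 : ℤ)⟧ ⟶ T, a = h ≫ b :=
  Triangle.yoneda_exact₃ _ hT a ha

lemma tri_iso₂ (hT : Triangle.mk f g h ∈ distTriang D) (α : Y ≅ T) :
    Triangle.mk (f ≫ α.hom) (α.inv ≫ g) h ∈ distTriang D := by
  have h1 : (f ≫ α.hom) ≫ α.inv = 𝟙 X ≫ f := by simp
  have h2 : (α.inv ≫ g) ≫ 𝟙 Z = α.inv ≫ g := by simp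
  have h3 : h ≫ (𝟙 X)⟦(1 : ℤ)⟧' = 𝟙 Z ≫ h := by simp
  exact isomorphic_distinguished _ hT _ (Triangle.isoMk _ _ (Iso.refl _) α.symm (Iso.refl _)
      h1 h2 h3)

lemma tri_unique {h' : Z ⟶ X⟦(1 : ℤ)⟧} (hT : Triangle.mk f g h ∈ distTriang D)
    (hT' : Triangle.mk f g h' ∈ distTriang D) : ∃ c : Z ⟶ Z, g ≫ c = g ∧ h = c ≫ h' := by
  have h1 : f ≫ 𝟙 Y = 𝟙 X ≫ f := by simp
  obtain ⟨c, hc1, hc2⟩ := complete_distinguished_triangle_morphism _ _ hT hT' (𝟙 X) (𝟙 Y) h1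
  replace hc1 : g ≫ c = 𝟙 Y ≫ g := hc1
  replace hc2 : h ≫ (𝟙 X)⟦(1 : ℤ)⟧' = c ≫ h' := hc2
  exact ⟨c, hc1.trans (Category.id_comp g),
    (by rw [CategoryTheory.Functor.map_id, Category.comp_id] : h = h ≫ (𝟙 X)⟦(1 : ℤ)⟧').trans hc2⟩

end Tri

variable {C : Type u} [Category.{v} C] [Abelian C]

/-- morphisms from a single complex to the negative shift vanish -/
lemma single_hom_zero [HasDerivedCategory.{w} C] (X Y : C)
    (φ : ((singleFunctor C 0).obj X)⟦(1 : ℤ)⟧ ⟶ (singleFunctor C 0).obj Y) : φ = 0 := by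
  have := (inferInstance : ((singleFunctor C 0).obj X).IsLE 0)
  have := (inferInstance : ((singleFunctor C 0).obj Y).IsGE 0)
  have : (((singleFunctor C 0).obj X)⟦(1 : ℤ)⟧).IsLE (-1) :=
    TStructure.t.isLE_shift _ 0 1 (-1) (by lia)
  exact TStructure.t.zero φ (-1) 0 (by lia)

lemma shortExact_of_lift {X Y Z : C} (f : X ⟶ Y) (g : Y ⟶ Z) (z : f ≫ g = 0) [Mono f] [Epi g]
    (H : ∀ {T : C} (a : T ⟶ Y), a ≫ g = 0 → ∃ b, b ≫ f = a) :
    (ShortComplex.mk f g z).ShortExact where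
  exact := ShortComplex.exact_of_f_is_kernel _
    (KernelFork.IsLimit.ofι' _ _ (fun a ha => ⟨_, (H a ha).choose_spec⟩))

lemma shortExact_of_desc {X Y Z : C} (f : X ⟶ Y) (g : Y ⟶ Z) (z : f ≫ g = 0) [Mono f] [Epi g]
    (H : ∀ {T : C} (a : Y ⟶ T), f ≫ a = 0 → ∃ b, g ≫ b = a) :
    (ShortComplex.mk f g z).ShortExact where
  exact := ShortComplex.exact_of_g_is_cokernel _
    (CokernelCofork.IsColimit.ofπ' _ _ (fun a ha => ⟨_, (H a ha).choose_spec⟩))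

lemma exists_ses [HasExt.{w} C] {X Y : C} (e : Ext.{w} X Y 1) :
    ∃ (M : C) (i : Y ⟶ M) (p : M ⟶ X) (z : i ≫ p = 0)
      (h : (ShortComplex.mk i p z).ShortExact), h.extClass = e := by
  let := HasDerivedCategory.standard C
  obtain ⟨ε, hε⟩ : ∃ ε : (singleFunctor C 0).obj X ⟶ ((singleFunctor C 0).obj Y)⟦(1:ℤ)⟧,
    ε = e.hom := ⟨_, rfl⟩
  obtain ⟨Z, f, g, hT⟩ := distinguished_cocone_triangle₂ ε
  have h1 : Z.IsLE 0 := TStructure.t.isLE₂ _ hT 0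
    (inferInstanceAs (((singleFunctor C 0).obj Y).IsLE 0))
    (inferInstanceAs (((singleFunctor C 0).obj X).IsLE 0))
  have h2 : Z.IsGE 0 := TStructure.t.isGE₂ _ hT 0
    (inferInstanceAs (((singleFunctor C 0).obj Y).IsGE 0))
    (inferInstanceAs (((singleFunctor C 0).obj X).IsGE 0))
  obtain ⟨M, ⟨α⟩⟩ := exists_iso_singleFunctor_obj_of_isGE_of_isLE Z 0
  obtain ⟨i, hi⟩ := (singleFunctor C 0).map_surjective (f ≫ α.hom)
  obtain ⟨p, hp⟩ := (singleFunctor C 0).map_surjective (α.inv ≫ g)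
  have hT' : Triangle.mk ((singleFunctor C 0).map i) ((singleFunctor C 0).map p) ε ∈
      distTriang (DerivedCategory C) := by
    rw [hi, hp]
    exact tri_iso₂ hT α
  have z : i ≫ p = 0 := (singleFunctor C 0).map_injective (by
    rw [Functor.map_comp, Functor.map_zero]
    exact tri_zero hT')
  have hmono : Mono i := Preadditive.mono_of_cancel_zero _ (fun {T} a ha => by
    obtain ⟨b, hb⟩ := tri_co₁ hT' (((singleFunctor C 0).map a)⟦(1 : ℤ)⟧') (by
        rw [← Functor.map_comp, ← Functor.map_comp, ha, Functor.map_zero, Functor.map_zero])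
    rw [single_hom_zero _ _ b, zero_comp] at hb
    refine (singleFunctor C 0).map_injective ((shiftFunctor _ (1 : ℤ)).map_injective ?_)
    rw [hb, Functor.map_zero, Functor.map_zero])
  have hepi : Epi p := Preadditive.epi_of_cancel_zero _ (fun {T} a ha => by
    obtain ⟨b, hb⟩ := tri_yo₃ hT' ((singleFunctor C 0).map a) (by
        rw [← Functor.map_comp, ha, Functor.map_zero])
    refine (singleFunctor C 0).map_injective ?_
    rw [hb, Functor.map_zero, single_hom_zero _ _ b, comp_zero])
  have hS : (ShortComplex.mk i p z).ShortExact := shortExact_of_lift i p z (fun {T} a ha => by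
    obtain ⟨b, hb⟩ := tri_co₂ hT' ((singleFunctor C 0).map a) (by
        rw [← Functor.map_comp, ha, Functor.map_zero])
    obtain ⟨b, rfl⟩ := (singleFunctor C 0).map_surjective b
    refine ⟨b, (singleFunctor C 0).map_injective ?_⟩
    rw [hb, Functor.map_comp])
  refine ⟨M, i, p, z, hS, ?_⟩
  ext
  rw [hS.extClass_hom, ← hε]
  obtain ⟨c, hc1, hc2⟩ := tri_unique (f := (singleFunctor C 0).map i) (g := (singleFunctor C 0).map p)
    (h := hS.singleδ) hS.singleTriangle_distinguished hT'
  obtain ⟨c, rfl⟩ := (singleFunctor C 0).map_surjective c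
  have hc : c = 𝟙 _ := by
    rw [← cancel_epi p]
    apply (singleFunctor C 0).map_injective
    rw [Functor.map_comp, Category.comp_id]
    exact hc1
  rw [hc2, hc, CategoryTheory.Functor.map_id, Category.id_comp]

/-- Existence of morphisms of extensions. -/
lemma exists_ses_map [HasExt.{w} C] {S S' : ShortComplex C} (h : S.ShortExact) (h' : S'.ShortExact)
    (a : S.X₁ ⟶ S'.X₁) (b : S.X₃ ⟶ S'.X₃)
    (hab : h.extClass.comp (Ext.mk₀ a) (add_zero 1) =
      (Ext.mk₀ b).comp h'.extClass (zero_add 1)) :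
    ∃ m : S.X₂ ⟶ S'.X₂, S.f ≫ m = a ≫ S'.f ∧ m ≫ S'.g = S.g ≫ b := by
  obtain ⟨x, hx⟩ := Ext.contravariant_sequence_exact₁ h S'.X₂ (Ext.mk₀ (a ≫ S'.f)) (add_zero 1) (by
    rw [← Ext.mk₀_comp_mk₀, ← Ext.comp_assoc _ _ _ (add_zero 1) (zero_add 0) (by lia), hab,
      Ext.comp_assoc _ _ _ (zero_add 1) (add_zero 1) (by lia), h'.extClass_comp, Ext.comp_zero])
  obtain ⟨m, rfl⟩ := Ext.homEquiv₀.symm.surjective x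
  rw [Ext.homEquiv₀_symm_apply, Ext.mk₀_comp_mk₀] at hx
  replace hx : S.f ≫ m = a ≫ S'.f := Ext.homEquiv₀.symm.injective hx
  have hz : S.f ≫ m ≫ S'.g = 0 := by rw [← Category.assoc, hx, Category.assoc, S'.zero, comp_zero]
  have := h.epi_g
  let k : S.X₃ ⟶ S'.X₃ := h.exact.desc (m ≫ S'.g) hz
  have hk : S.g ≫ k = m ≫ S'.g := h.exact.g_desc _ _
  have hk' := ShortComplex.ShortExact.extClass_naturality h h'
    { τ₁ := a, τ₂ := m, τ₃ := k, comm₁₂ := hx.symm, comm₂₃ := hk.symm }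
  obtain ⟨y, hy⟩ := Ext.covariant_sequence_exact₃ S.X₃ h' (Ext.mk₀ (k - b)) (zero_add 1) (by
    rw [sub_eq_add_neg, Ext.mk₀_add, Ext.mk₀_neg, Ext.add_comp, Ext.neg_comp, ← hab]
    exact add_neg_eq_zero.2 hk'.symm)
  obtain ⟨r, rfl⟩ := Ext.homEquiv₀.symm.surjective y
  rw [Ext.homEquiv₀_symm_apply, Ext.mk₀_comp_mk₀] at hy
  replace hy : r ≫ S'.g = k - b := Ext.homEquiv₀.symm.injective hy
  refine ⟨m - S.g ≫ r, ?_, ?_⟩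
  · simp [hx]
  · rw [Preadditive.sub_comp, Category.assoc, hy, Preadditive.comp_sub, hk, sub_sub_cancel]

end ExtGeneral

section Disc

variable {A : Type} [SmallCategory A] [Abelian A] {t : ℕ}

/-- reducible version of mkZero -/
abbrev mz (f : ZMod t → A) : Ct A t where
  X := f
  d _ _ := 0
  shape _ _ _ := rfl
  d_comp_d' := by intros; simp

lemma pRel (i : ZMod t) : (pShape t).Rel i (i + 1) := rfl

/-- constructor for morphisms of periodic complexes -/
def mkHom (X Y : Ct A t) (f : ∀ i, X.X i ⟶ Y.X i)
    (h : ∀ i, f i ≫ Y.d i (i + 1) = X.d i (i + 1) ≫ f (i + 1)) : X ⟶ Y where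
  f := f
  comm' := by
    intro i j hij
    obtain rfl : i + 1 = j := hij
    exact h i

lemma mkHom_f (X Y : Ct A t) (f : ∀ i, X.X i ⟶ Y.X i)
    (h : ∀ i, f i ≫ Y.d i (i + 1) = X.d i (i + 1) ≫ f (i + 1)) (i : ZMod t) :
    (mkHom X Y f h).f i = f i := rfl

lemma mz_d (f : ZMod t → A) (i j : ZMod t) : (mz f).d i j = 0 := rfl

/-- functoriality of `mz` -/
def mzMap {f g : ZMod t → A} (a : ∀ i, f i ⟶ g i) : mz f ⟶ mz g :=
  mkHom (mz f) (mz g) a (fun i => by rw [mz_d, mz_d, comp_zero, zero_comp])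

lemma mzMap_f {f g : ZMod t → A} (a : ∀ i, f i ⟶ g i) (i : ZMod t) : (mzMap a).f i = a i := rfl

lemma mzMap_comp {f g h : ZMod t → A} (a : ∀ i, f i ⟶ g i) (b : ∀ i, g i ⟶ h i) :
    mzMap a ≫ mzMap b = mzMap (fun i => a i ≫ b i) := by
  ext i; rfl

lemma mzMap_add {f g : ZMod t → A} (a b : ∀ i, f i ⟶ g i) :
    mzMap (fun i => a i + b i) = mzMap a + mzMap b := by
  ext i; rfl

lemma mzMap_id (f : ZMod t → A) : mzMap (fun i => 𝟙 (f i)) = 𝟙 (mz f) := by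
  ext i; rfl

lemma mzMap_self {f g : ZMod t → A} (a : mz f ⟶ mz g) : mzMap (fun i => a.f i) = a := by
  ext i; rfl

/-- sum of discs -/
abbrev disc (g : ZMod t → A) : Ct A t where
  X i := g i ⊞ g (i + 1)
  d i j := if h : i + 1 = j then biprod.snd ≫ eqToHom (by rw [h]) ≫ biprod.inl else 0
  shape i j h := dif_neg h
  d_comp_d' := by
    intro i j k hij hjk
    obtain rfl : i + 1 = j := hij
    obtain rfl : i + 1 + 1 = k := hjk
    simp

lemma disc_d (g : ZMod t → A) (i : ZMod t) :
    (disc g).d i (i + 1) = (biprod.snd ≫ biprod.inl : g i ⊞ g (i + 1) ⟶ g (i+1) ⊞ g (i + 1 + 1)) := by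
  simp [disc]

def discι (g : ZMod t → A) : mz g ⟶ disc g :=
  mkHom (mz g) (disc g) (fun i => (biprod.inl : g i ⟶ g i ⊞ g (i + 1))) (fun i => by
    rw [disc_d, mz_d, zero_comp]
    exact (biprod.inl_snd_assoc (X := g i) _).trans zero_comp)

lemma discι_f (g : ZMod t → A) (i : ZMod t) :
    (discι g).f i = (biprod.inl : g i ⟶ g i ⊞ g (i + 1)) := rfl

def discπ (g : ZMod t → A) : disc g ⟶ mz (fun i => g (i + 1)) :=
  mkHom (disc g) (mz (fun i => g (i + 1)))
   (fun i => (biprod.snd : g i ⊞ g (i + 1) ⟶ g (i + 1))) (fun i => by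
    rw [disc_d, mz_d, comp_zero]
    simp)

lemma discπ_f (g : ZMod t → A) (i : ZMod t) :
    (discπ g).f i = (biprod.snd : g i ⊞ g (i + 1) ⟶ g (i + 1)) := rfl

lemma disc_zero (g : ZMod t → A) : discι g ≫ discπ g = 0 := by
  ext i
  exact biprod.inl_snd (X := g i) (Y := g (i + 1))

lemma disc_ses (g : ZMod t → A) :
    (ShortComplex.mk (discι g) (discπ g) (disc_zero g)).ShortExact := by
  apply HomologicalComplex.shortExact_of_degreewise_shortExact
  intro i
  have := (ShortComplex.Splitting.ofHasBinaryBiproduct (g i) (g (i + 1))).shortExact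
  exact this

def discMap {f g : ZMod t → A} (a : ∀ i, f i ⟶ g i) : disc f ⟶ disc g :=
  mkHom (disc f) (disc g)
  (fun i => (biprod.map (a i) (a (i + 1)) : f i ⊞ f (i + 1) ⟶ g i ⊞ g (i + 1)))
  (fun i => by
    rw [disc_d, disc_d]
    simp)

lemma discι_map {f g : ZMod t → A} (a : ∀ i, f i ⟶ g i) :
    discι f ≫ discMap a = mzMap a ≫ discι g := by
  refine HomologicalComplex.hom_ext _ _ (fun i => ?_)
  exact biprod.inl_map (a i) (a (i + 1))

lemma discMap_π {f g : ZMod t → A} (a : ∀ i, f i ⟶ g i) :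
    discMap a ≫ discπ g = discπ f ≫ mzMap (fun i => a (i + 1)) := by
  refine HomologicalComplex.hom_ext _ _ (fun i => ?_)
  exact biprod.map_snd (a i) (a (i + 1))

lemma exactAt_succ (X : Ct A t) (i : ZMod t)
    (H : (ShortComplex.mk (X.d i (i + 1)) (X.d (i + 1) (i + 1 + 1)) (X.d_comp_d _ _ _)).Exact) :
    X.ExactAt (i + 1) := by
  rw [X.exactAt_iff' i (i + 1) (i + 1 + 1) ((pShape t).prev_eq' (pRel i))
    ((pShape t).next_eq' (pRel (i + 1)))]
  exact H

lemma forall_succ {P : ZMod t → Prop} (h : ∀ i, P (i + 1)) (i : ZMod t) : P i := by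
  have := h (i - 1)
  rwa [sub_add_cancel] at this

lemma disc_acyclic (g : ZMod t → A) : (disc g).Acyclic := by
  refine forall_succ (fun i => exactAt_succ _ i ?_)
  rw [ShortComplex.exact_iff_exact_up_to_refinements]
  intro T x hx
  obtain ⟨y, rfl⟩ : ∃ y : T ⟶ g (i + 1) ⊞ g (i + 1 + 1), y = x := ⟨x, rfl⟩
  refine ⟨T, 𝟙 T, inferInstance,
    ((y ≫ biprod.fst : T ⟶ g (i + 1)) ≫ biprod.inr : T ⟶ g i ⊞ g (i + 1)), ?_⟩
  replace hx : y ≫ (disc g).d (i + 1) (i + 1 + 1) = 0 := hx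
  change 𝟙 T ≫ y = ((y ≫ biprod.fst) ≫ biprod.inr) ≫ (disc g).d i (i + 1)
  rw [disc_d] at hx ⊢
  have hy : y ≫ biprod.snd = 0 := by
    rw [← cancel_mono (biprod.inl : g (i + 1 + 1) ⟶ g (i + 1 + 1) ⊞ g (i + 1 + 1 + 1)),
      Category.assoc, zero_comp]
    exact hx
  rw [Category.id_comp]
  refine biprod.hom_ext _ _ ?_ ?_
  · simp
  · simp [hy]

lemma d_eqToHom (Q : Ct A t) (g : ZMod t → A) (y : ∀ i, g (i + 1) ⟶ Q.X i) (i j : ZMod t)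
    (h : j = i) (h' : g (i + 1) = g (j + 1)) :
    eqToHom h' ≫ y j ≫ Q.d j (i + 1) = y i ≫ Q.d i (i + 1) := by
  subst h; simp

/-- Morphisms out of a disc. -/
def discDesc (g : ZMod t → A) (Q : Ct A t) (y : ∀ i, g (i + 1) ⟶ Q.X i) : disc g ⟶ Q :=
  mkHom (disc g) Q
  (fun i => (biprod.desc (eqToHom (by rw [sub_add_cancel]) ≫ y (i - 1) ≫ Q.d (i - 1) i) (y i) :
    g i ⊞ g (i + 1) ⟶ Q.X i))
  (fun i => by
    rw [disc_d]
    refine biprod.hom_ext' _ _ ?_ ?_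
    · simp
    · simp only [biprod.inr_desc_assoc, Category.assoc, biprod.inr_snd_assoc, biprod.inl_desc]
      exact (d_eqToHom Q g y i _ (by simp) _).symm)

lemma discDesc_inr (g : ZMod t → A) (Q : Ct A t) (y : ∀ i, g (i + 1) ⟶ Q.X i) (i : ZMod t) :
    (biprod.inr : g (i + 1) ⟶ g i ⊞ g (i + 1)) ≫ (discDesc g Q y).f i = y i :=
  biprod.inr_desc _ _

lemma discDesc_inl (g : ZMod t → A) (Q : Ct A t) (y : ∀ i, g (i + 1) ⟶ Q.X i) (i : ZMod t) :
    (biprod.inl : g (i + 1) ⟶ g (i + 1) ⊞ g (i + 1 + 1)) ≫ (discDesc g Q y).f (i + 1) =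
      y i ≫ Q.d i (i + 1) :=
  (biprod.inl_desc _ _).trans (d_eqToHom Q g y i _ (by simp) _)

lemma disc_hom_ext (g : ZMod t → A) (Q : Ct A t) (a b : disc g ⟶ Q)
    (h : ∀ i, (biprod.inr : g (i + 1) ⟶ g i ⊞ g (i + 1)) ≫ a.f i =
       (biprod.inr : g (i + 1) ⟶ g i ⊞ g (i + 1)) ≫ b.f i) : a = b := by
  have key : ∀ (a : disc g ⟶ Q) (i : ZMod t),
      (biprod.inl : g (i + 1) ⟶ g (i + 1) ⊞ g (i + 1 + 1)) ≫ a.f (i + 1) =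
      ((biprod.inr : g (i + 1) ⟶ g i ⊞ g (i + 1)) ≫ a.f i) ≫ Q.d i (i + 1) := by
    intro a i
    have := a.comm i (i + 1)
    rw [Category.assoc, this, disc_d, Category.assoc]
    exact (biprod.inr_snd_assoc (X := g i) (Y := g (i + 1)) _).symm
  refine HomologicalComplex.hom_ext _ _ ?_
  refine forall_succ (fun i => ?_)
  refine biprod.hom_ext' _ _ ?_ ?_
  · exact (key a i).trans ((congrArg (· ≫ _) (h i)).trans (key b i).symm)
  · exact h (i + 1)

end Disc

section Cone

variable {A : Type} [SmallCategory A] [Abelian A] {t : ℕ}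

/-- the class of quasi-isomorphisms -/
abbrev qis (A : Type) [SmallCategory A] [Abelian A] (t : ℕ) : MorphismProperty (Ct A t) :=
  HomologicalComplex.quasiIso A (pShape t)

lemma qi_of_ses {X Y Z : Ct A t} (f : X ⟶ Y) (g : Y ⟶ Z) (z : f ≫ g = 0)
    (h : (ShortComplex.mk f g z).ShortExact) (hX : X.Acyclic) : qis A t g := by
  refine (HomologicalComplex.mem_quasiIso_iff _).2 ⟨fun i => ?_⟩
  rw [quasiIsoAt_iff_isIso_homologyMap]
  have h0 : ∀ j, IsZero (X.homology j) := fun j => by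
    have := hX j
    rwa [HomologicalComplex.exactAt_iff_isZero_homology] at this
  have e2 := h.homology_exact₂ i
  have e3 := h.homology_exact₃ i (i + 1) (pRel i)
  have : Mono (HomologicalComplex.homologyMap g i) := e2.mono_g ((h0 i).eq_of_src _ _)
  have : Epi (HomologicalComplex.homologyMap g i) := e3.epi_f ((h0 (i + 1)).eq_of_tgt _ _)
  exact isIso_of_mono_of_epi _

lemma zero_qi (X : Ct A t) (hX : X.Acyclic) : qis A t (0 : X ⟶ X) := by
  refine (HomologicalComplex.mem_quasiIso_iff _).2 ⟨fun i => ?_⟩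
  rw [quasiIsoAt_iff_isIso_homologyMap]
  have h0 : IsZero (X.homology i) := by
    have := hX i
    rwa [HomologicalComplex.exactAt_iff_isZero_homology] at this
  exact ⟨0, h0.eq_of_src _ _, h0.eq_of_src _ _⟩

variable {g : ZMod t → A} {M X : Ct A t} (ι : mz g ⟶ M) (p : M ⟶ X) (z : ι ≫ p = 0)

/-- the cone -/
abbrev cone : Ct A t := pushout ι (discι g)

/-- the map from the cone to the right end -/
def coneS : cone ι ⟶ X := pushout.desc p 0 (by rw [z, comp_zero])

/-- the map from the cone to the shift of the left end -/
def coneC : cone ι ⟶ mz (fun i => g (i + 1)) :=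
  pushout.desc 0 (discπ g) (by rw [disc_zero, comp_zero])

/-- inclusion -/
abbrev coneL : M ⟶ cone ι := pushout.inl ι (discι g)

/-- inclusion of the disc -/
abbrev coneR : disc g ⟶ cone ι := pushout.inr ι (discι g)

lemma coneL_S : coneL ι ≫ coneS ι p z = p := pushout.inl_desc _ _ _
lemma coneR_S : coneR ι ≫ coneS ι p z = 0 := pushout.inr_desc _ _ _
lemma coneL_C : coneL ι ≫ coneC ι = 0 := pushout.inl_desc _ _ _
lemma coneR_C : coneR ι ≫ coneC ι = discπ g := pushout.inr_desc _ _ _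

lemma cone_ses (h : (ShortComplex.mk ι p z).ShortExact) :
    (ShortComplex.mk (coneR ι) (coneS ι p z) (coneR_S ι p z)).ShortExact := by
  have : Mono ι := h.mono_f
  have : Epi p := h.epi_g
  have : Epi (coneS ι p z) := epi_of_epi_fac (coneL_S ι p z)
  refine shortExact_of_desc _ _ _ (fun {T} a ha => ?_)
  have h1 : ι ≫ coneL ι ≫ a = 0 := by
    rw [← Category.assoc, pushout.condition, Category.assoc, ha, comp_zero]
  obtain ⟨b, hb⟩ := CokernelCofork.IsColimit.desc' h.gIsCokernel _ h1
  replace hb : p ≫ b = coneL ι ≫ a := hb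
  refine ⟨b, ?_⟩
  apply pushout.hom_ext
  · rw [← Category.assoc, coneL_S, hb]
  · rw [← Category.assoc, coneR_S, zero_comp, ha]

lemma cone_ses' (_h : Mono ι) :
    (ShortComplex.mk (coneL ι) (coneC ι) (coneL_C ι)).ShortExact := by
  have hd := disc_ses g
  have : Mono (discι g) := hd.mono_f
  have : Epi (discπ g) := hd.epi_g
  have : Epi (coneC ι) := epi_of_epi_fac (coneR_C ι)
  refine shortExact_of_desc _ _ _ (fun {T} a ha => ?_)
  have h1 : discι g ≫ coneR ι ≫ a = 0 := by
    rw [← Category.assoc, ← pushout.condition, Category.assoc, ha, comp_zero]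
  obtain ⟨b, hb⟩ := CokernelCofork.IsColimit.desc' hd.gIsCokernel _ h1
  replace hb : discπ g ≫ b = coneR ι ≫ a := hb
  refine ⟨b, ?_⟩
  apply pushout.hom_ext
  · rw [← Category.assoc, coneL_C, zero_comp, ha]
  · rw [← Category.assoc, coneR_C, hb]

lemma coneS_qi (h : (ShortComplex.mk ι p z).ShortExact) : qis A t (coneS ι p z) :=
  qi_of_ses _ _ _ (cone_ses ι p z h) (disc_acyclic g)

end Cone

section Delta

variable {A : Type} [SmallCategory A] [Abelian A] {t : ℕ}
  {E : Type*} [Category E] [Preadditive E] (L : Ct A t ⥤ E) [L.Additive]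
    [L.IsLocalization (qis A t)]

lemma isIso_L {X Y : Ct A t} (s : X ⟶ Y) (hs : qis A t s) : IsIso (L.map s) :=
  Localization.inverts L (qis A t) s hs

lemma L_fac_acyclic {X Y D : Ct A t} (hD : D.Acyclic) (a : X ⟶ D) (b : D ⟶ Y) :
    L.map (a ≫ b) = 0 := by
  have := isIso_L L _ (zero_qi D hD)
  have h : L.map (𝟙 D) = 0 := by
    rw [← cancel_mono (L.map (0 : D ⟶ D)), zero_comp, L.map_zero, comp_zero]
  rw [← Category.id_comp b, L.map_comp, L.map_comp, h, zero_comp, comp_zero]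

variable {g : ZMod t → A} {M X : Ct A t} (ι : mz g ⟶ M) (p : M ⟶ X) (z : ι ≫ p = 0)
  (h : (ShortComplex.mk ι p z).ShortExact)

/-- connecting morphism -/
def δ : L.obj X ⟶ L.obj (mz (fun i => g (i + 1))) :=
  have := isIso_L L _ (coneS_qi ι p z h)
  inv (L.map (coneS ι p z)) ≫ L.map (coneC ι)

lemma δ_spec : L.map (coneS ι p z) ≫ δ L ι p z h = L.map (coneC ι) := by
  have := isIso_L L _ (coneS_qi ι p z h)
  exact IsIso.hom_inv_id_assoc _ _

lemma δ_unique (θ) (hθ : L.map (coneS ι p z) ≫ θ = L.map (coneC ι)) : δ L ι p z h = θ := by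
  have := isIso_L L _ (coneS_qi ι p z h)
  rw [← cancel_epi (L.map (coneS ι p z)), hθ, δ_spec]

lemma δ_nat {g' : ZMod t → A} {M' X' : Ct A t} (ι' : mz g' ⟶ M') (p' : M' ⟶ X') (z' : ι' ≫ p' = 0)
    (h' : (ShortComplex.mk ι' p' z').ShortExact) (a : ∀ i, g i ⟶ g' i) (m : M ⟶ M') (b : X ⟶ X')
    (h1 : ι ≫ m = mzMap a ≫ ι') (h2 : m ≫ p' = p ≫ b) :
    L.map b ≫ δ L ι' p' z' h' = δ L ι p z h ≫ L.map (mzMap (fun i => a (i + 1))) := by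
  have := isIso_L L _ (coneS_qi ι p z h)
  let u : cone ι ⟶ cone ι' := pushout.desc (m ≫ coneL ι') (discMap a ≫ coneR ι') (by
    rw [← Category.assoc, h1, Category.assoc, pushout.condition, ← Category.assoc,
      ← discι_map, Category.assoc])
  have hu1 : coneL ι ≫ u = m ≫ coneL ι' := pushout.inl_desc _ _ _
  have hu2 : coneR ι ≫ u = discMap a ≫ coneR ι' := pushout.inr_desc _ _ _
  have e1 : coneS ι p z ≫ b = u ≫ coneS ι' p' z' := by
    apply pushout.hom_ext
    · rw [← Category.assoc, coneL_S, ← Category.assoc, hu1, Category.assoc, coneL_S, h2]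
    · rw [← Category.assoc, coneR_S, zero_comp, ← Category.assoc, hu2, Category.assoc, coneR_S,
        comp_zero]
  have e2 : coneC ι ≫ mzMap (fun i => a (i + 1)) = u ≫ coneC ι' := by
    apply pushout.hom_ext
    · rw [← Category.assoc, coneL_C, zero_comp, ← Category.assoc, hu1, Category.assoc, coneL_C,
        comp_zero]
    · rw [← Category.assoc, coneR_C, ← Category.assoc, hu2, Category.assoc, coneR_C, discMap_π]
  rw [← cancel_epi (L.map (coneS ι p z)), ← Category.assoc, ← L.map_comp, e1, L.map_comp,
    Category.assoc, δ_spec, ← L.map_comp, ← e2, L.map_comp, ← Category.assoc, δ_spec]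

/-- the connecting morphism of the disc sequence is minus the identity -/
lemma δ_disc (g : ZMod t → A) : δ L (discι g) (discπ g) (disc_zero g) (disc_ses g) = - 𝟙 _ := by
  apply δ_unique
  let u : cone (discι g) ⟶ disc g := pushout.desc (𝟙 _) (𝟙 _) rfl
  have hu1 : coneL (discι g) ≫ u = 𝟙 _ := pushout.inl_desc _ _ _
  have hu2 : coneR (discι g) ≫ u = 𝟙 _ := pushout.inr_desc _ _ _
  have e : coneS (discι g) (discπ g) (disc_zero g) + coneC (discι g) = u ≫ discπ g := by
    apply pushout.hom_ext
    · rw [Preadditive.comp_add, coneL_S, coneL_C, ← Category.assoc, hu1, add_zero, Category.id_comp]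
    · rw [Preadditive.comp_add, coneR_S, coneR_C, ← Category.assoc, hu2, zero_add, Category.id_comp]
  have e' : L.map (u ≫ discπ g) = 0 := L_fac_acyclic L (disc_acyclic g) _ _
  rw [← e, L.map_add] at e'
  rw [Preadditive.comp_neg, Category.comp_id]
  exact neg_eq_of_add_eq_zero_right e'

end Delta

section Phi

open Abelian

variable {A : Type} [SmallCategory A] [Abelian A] {t : ℕ}
  {E : Type*} [Category E] [Preadditive E] (L : Ct A t ⥤ E) [L.Additive]
    [L.IsLocalization (qis A t)] [HasExt.{0} (Ct A t)]

/-- the comparison map on extension classes -/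
def phi {X : Ct A t} {g : ZMod t → A} (e : Ext.{0} X (mz g) 1) :
    L.obj X ⟶ L.obj (mz (fun i => g (i + 1))) :=
  δ L _ _ _ (exists_ses e).choose_spec.choose_spec.choose_spec.choose_spec.choose

lemma phi_exists {X : Ct A t} {g : ZMod t → A} (e : Ext.{0} X (mz g) 1) :
    ∃ (M : Ct A t) (ι : mz g ⟶ M) (p : M ⟶ X) (z : ι ≫ p = 0)
      (h : (ShortComplex.mk ι p z).ShortExact), h.extClass = e ∧ phi L e = δ L ι p z h :=
  ⟨_, _, _, _, _, (exists_ses e).choose_spec.choose_spec.choose_spec.choose_spec.choose_spec, rfl⟩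

lemma phi_nat {X X' : Ct A t} {g g' : ZMod t → A} (e : Ext.{0} X (mz g) 1)
    (e' : Ext.{0} X' (mz g') 1) (a : ∀ i, g i ⟶ g' i) (b : X ⟶ X')
    (hab : e.comp (Ext.mk₀ (mzMap a)) (add_zero 1) = (Ext.mk₀ b).comp e' (zero_add 1)) :
    L.map b ≫ phi L e' = phi L e ≫ L.map (mzMap (fun i => a (i + 1))) := by
  obtain ⟨M, ι, p, z, h, h1, h2⟩ := phi_exists L e
  obtain ⟨M', ι', p', z', h', h1', h2'⟩ := phi_exists L e'
  rw [h2, h2']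
  subst h1 h1'
  obtain ⟨m, hm1, hm2⟩ := exists_ses_map h h' (mzMap a) b hab
  exact δ_nat L ι p z h ι' p' z' h' a m b hm1 hm2

lemma phi_ses {g : ZMod t → A} {M X : Ct A t} (ι : mz g ⟶ M) (p : M ⟶ X) (z : ι ≫ p = 0)
    (h : (ShortComplex.mk ι p z).ShortExact) : phi L h.extClass = δ L ι p z h := by
  obtain ⟨M', ι', p', z', h', h1', h2'⟩ := phi_exists L h.extClass
  rw [h2']
  have hab : h.extClass.comp (Ext.mk₀ (mzMap (fun i => 𝟙 (g i)))) (add_zero 1) =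
      (Ext.mk₀ (𝟙 X)).comp h'.extClass (zero_add 1) := by
    rw [mzMap_id, Ext.comp_mk₀_id, Ext.mk₀_id_comp, h1']
  obtain ⟨m, hm1, hm2⟩ := exists_ses_map h h' (mzMap (fun i => 𝟙 (g i))) (𝟙 X) hab
  have := δ_nat L ι p z h ι' p' z' h' _ m (𝟙 X) hm1 hm2
  rw [CategoryTheory.Functor.map_id, Category.id_comp, mzMap_id (fun i => g (i + 1)),
    CategoryTheory.Functor.map_id, Category.comp_id] at this
  exact this

lemma phi_post {X : Ct A t} {g g' : ZMod t → A} (e : Ext.{0} X (mz g) 1) (a : ∀ i, g i ⟶ g' i) :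
    phi L (e.comp (Ext.mk₀ (mzMap a)) (add_zero 1)) =
      phi L e ≫ L.map (mzMap (fun i => a (i + 1))) := by
  rw [← phi_nat L e _ a (𝟙 X) (by rw [Ext.mk₀_id_comp]), CategoryTheory.Functor.map_id,
    Category.id_comp]

lemma phi_pre {X X' : Ct A t} {g : ZMod t → A} (e : Ext.{0} X' (mz g) 1) (b : X ⟶ X') :
    phi L ((Ext.mk₀ b).comp e (zero_add 1)) = L.map b ≫ phi L e := by
  rw [phi_nat L ((Ext.mk₀ b).comp e (zero_add 1)) e (fun i => 𝟙 _) b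
    (by rw [mzMap_id, Ext.comp_mk₀_id]), mzMap_id (fun i => g (i + 1)),
    CategoryTheory.Functor.map_id, Category.comp_id]

lemma phi_add {X : Ct A t} {g : ZMod t → A} (e₁ e₂ : Ext.{0} X (mz g) 1) :
    phi L (e₁ + e₂) = phi L e₁ + phi L e₂ := by
  let G : ZMod t → A := fun i => g i ⊞ g i
  let i₁ : ∀ i, g i ⟶ G i := fun i => biprod.inl
  let i₂ : ∀ i, g i ⟶ G i := fun i => biprod.inr
  let p₁ : ∀ i, G i ⟶ g i := fun i => biprod.fst
  let p₂ : ∀ i, G i ⟶ g i := fun i => biprod.snd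
  let w : Ext.{0} X (mz G) 1 := e₁.comp (Ext.mk₀ (mzMap i₁)) (add_zero 1) +
    e₂.comp (Ext.mk₀ (mzMap i₂)) (add_zero 1)
  have h11 : mzMap i₁ ≫ mzMap p₁ = 𝟙 _ := by
    rw [mzMap_comp, ← mzMap_id]; congr 1; funext i; exact biprod.inl_fst
  have h12 : mzMap i₁ ≫ mzMap p₂ = 0 := by
    rw [mzMap_comp]; refine HomologicalComplex.hom_ext _ _ (fun i => ?_); exact biprod.inl_snd
  have h21 : mzMap i₂ ≫ mzMap p₁ = 0 := by
    rw [mzMap_comp]; refine HomologicalComplex.hom_ext _ _ (fun i => ?_); exact biprod.inr_fst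
  have h22 : mzMap i₂ ≫ mzMap p₂ = 𝟙 _ := by
    rw [mzMap_comp, ← mzMap_id]; congr 1; funext i; exact biprod.inr_snd
  have w1 : w.comp (Ext.mk₀ (mzMap p₁)) (add_zero 1) = e₁ := by
    simp only [w, Ext.add_comp, Ext.comp_assoc_of_third_deg_zero, Ext.mk₀_comp_mk₀, h11, h21,
      Ext.comp_mk₀_id, Ext.mk₀_zero, Ext.comp_zero, add_zero]
  have w2 : w.comp (Ext.mk₀ (mzMap p₂)) (add_zero 1) = e₂ := by
    simp only [w, Ext.add_comp, Ext.comp_assoc_of_third_deg_zero, Ext.mk₀_comp_mk₀, h12, h22,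
      Ext.comp_mk₀_id, Ext.mk₀_zero, Ext.comp_zero, zero_add]
  have w3 : e₁ + e₂ = w.comp (Ext.mk₀ (mzMap (fun i => p₁ i + p₂ i))) (add_zero 1) := by
    rw [mzMap_add, Ext.mk₀_add, Ext.comp_add, w1, w2]
  rw [w3, phi_post, mzMap_add (fun i => p₁ (i + 1)) (fun i => p₂ (i + 1)), L.map_add,
    Preadditive.comp_add, ← phi_post, ← phi_post, w1, w2]

end Phi

section Roof

variable {A : Type} [SmallCategory A] [Abelian A] {t : ℕ}

/-- every complex is a quotient of a disc -/
lemma disc_cover (Y : Ct A t) : ∃ (K : ZMod t → A) (ε : disc K ⟶ Y), Epi ε := by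
  refine ⟨fun i => Y.X (i - 1), discDesc _ Y (fun i => eqToHom (by simp)), ?_⟩
  have : ∀ i, Epi ((discDesc (fun i => Y.X (i - 1)) Y (fun i => eqToHom (by simp))).f i) :=
    fun i => epi_of_epi_fac (discDesc_inr (fun i => Y.X (i - 1)) Y (fun i => eqToHom (by simp)) i)
  exact HomologicalComplex.epi_of_epi_f _ this

lemma qi_pullback {B Y Z : Ct A t} (a : B ⟶ Z) (w : Y ⟶ Z) (hw : qis A t w) [Epi w] :
    qis A t (pullback.fst a w) := by
  have h1 : (ShortComplex.mk (kernel.ι w) w (kernel.condition w)).ShortExact :=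
    shortExact_of_lift _ _ _ (fun a ha => ⟨kernel.lift w a ha, kernel.lift_ι w a ha⟩)
  have h2 : (kernel w).Acyclic := h1.acyclic_X₁ hw
  let k : kernel w ⟶ pullback a w := pullback.lift 0 (kernel.ι w) (by simp)
  have hk1 : k ≫ pullback.fst a w = 0 := pullback.lift_fst _ _ _
  have hk2 : k ≫ pullback.snd a w = kernel.ι w := pullback.lift_snd _ _ _
  have : Mono k := mono_of_mono_fac hk2
  have h3 : (ShortComplex.mk k (pullback.fst a w) hk1).ShortExact := by
    refine shortExact_of_lift _ _ _ (fun b hb => ?_)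
    have hb' : (b ≫ pullback.snd a w) ≫ w = 0 := by
      rw [Category.assoc, ← pullback.condition, ← Category.assoc, hb, zero_comp]
    refine ⟨kernel.lift w _ hb', ?_⟩
    apply pullback.hom_ext
    · rw [Category.assoc, hk1, comp_zero, hb]
    · rw [Category.assoc, hk2, kernel.lift_ι]
  exact qi_of_ses _ _ _ h3 h2

lemma qi_fst (Y D : Ct A t) (hD : D.Acyclic) : qis A t (biprod.fst : Y ⊞ D ⟶ Y) := by
  have : (ShortComplex.mk (biprod.inr : D ⟶ Y ⊞ D) biprod.fst (by simp)).ShortExact := by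
    refine shortExact_of_lift _ _ _ (fun a ha => ⟨a ≫ biprod.snd, ?_⟩)
    apply biprod.hom_ext
    · simp [ha]
    · simp
  exact qi_of_ses _ _ _ this hD

lemma qi_inl (Y D : Ct A t) (hD : D.Acyclic) : qis A t (biprod.inl : Y ⟶ Y ⊞ D) := by
  refine (qis A t).of_postcomp _ _ (qi_fst Y D hD) ?_
  rw [biprod.inl_fst]
  exact (qis A t).id_mem _

lemma ore {E : Type*} [Category E] (F : Ct A t ⥤ E) (hF : (qis A t).IsInvertedBy F)
    {B Y Z : Ct A t} (a : B ⟶ Z) (w : Y ⟶ Z) (hw : qis A t w) :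
    ∃ (B' : Ct A t) (s : B' ⟶ B) (_ : qis A t s) (a' : B' ⟶ Y),
      F.map s ≫ F.map a = F.map a' ≫ F.map w := by
  obtain ⟨K, ε, hε⟩ := disc_cover Z
  have hD := disc_acyclic K
  let w' : Y ⊞ disc K ⟶ Z := biprod.desc w ε
  have e1 : biprod.inl ≫ w' = w := biprod.inl_desc _ _
  have e2 : biprod.inr ≫ w' = ε := biprod.inr_desc _ _
  have : Epi w' := epi_of_epi_fac e2
  have hw' : qis A t w' := by
    refine (qis A t).of_precomp _ _ (qi_inl Y _ hD) ?_
    rw [e1]; exact hw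
  refine ⟨_, pullback.fst a w', qi_pullback a w' hw', pullback.snd a w' ≫ biprod.fst, ?_⟩
  have h1 := hF _ (qi_inl Y _ hD)
  have h2 : F.map w' = F.map (biprod.fst : Y ⊞ disc K ⟶ Y) ≫ F.map w := by
    rw [← cancel_epi (F.map (biprod.inl : Y ⟶ Y ⊞ disc K)), ← F.map_comp, e1, ← F.map_comp_assoc,
      biprod.inl_fst, F.map_id, Category.id_comp]
  rw [← F.map_comp, pullback.condition, F.map_comp, h2, F.map_comp, Category.assoc]

/-- `θ` is given by a roof -/
def IsRoof (X : Ct A t) (Y : (qis A t).Localization) (θ : (qis A t).Q.obj X ⟶ Y) : Prop :=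
  ∃ (B Y' : Ct A t) (e : (qis A t).Q.obj Y' = Y) (s : B ⟶ X) (_ : qis A t s) (a : B ⟶ Y'),
    (qis A t).Q.map s ≫ θ = (qis A t).Q.map a ≫ eqToHom e

/-- post-composition preserves roofs -/
def roofProp : MorphismProperty (qis A t).Localization :=
  fun Y Z φ => ∀ (X : Ct A t) (θ : (qis A t).Q.obj X ⟶ Y), IsRoof X Y θ → IsRoof X Z (θ ≫ φ)

instance : (roofProp (A := A) (t := t)).IsStableUnderComposition where
  comp_mem f g hf hg := fun X θ hθ => by
    rw [← Category.assoc]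
    exact hg X _ (hf X _ hθ)

lemma roofProp_top : (roofProp (A := A) (t := t)) = ⊤ := by
  apply Localization.Construction.morphismProperty_eq_top
  · intro Y Z f X θ hθ
    obtain ⟨B, Y', e, s, hs, a, h⟩ := hθ
    obtain rfl := (Localization.Construction.objEquiv (qis A t)).injective e
    refine ⟨B, Z, rfl, s, hs, a ≫ f, ?_⟩
    rw [← Category.assoc, h, eqToHom_refl, Category.comp_id, eqToHom_refl, Category.comp_id,
      Functor.map_comp]
  · intro Y Z w hw X θ hθ
    obtain ⟨B, Y', e, s, hs, a, h⟩ := hθ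
    obtain rfl := (Localization.Construction.objEquiv (qis A t)).injective e
    obtain ⟨B', s', hs', a', h'⟩ := ore (qis A t).Q (qis A t).Q_inverts a w hw
    refine ⟨B', Y, rfl, s' ≫ s, (qis A t).comp_mem _ _ hs' hs, a', ?_⟩
    have h2 : (qis A t).Q.map w = (Localization.Construction.wIso w hw).hom := rfl
    rw [eqToHom_refl, Category.comp_id] at h
    rw [eqToHom_refl, Category.comp_id, Functor.map_comp, Category.assoc, reassoc_of% h,
      reassoc_of% h', h2, Iso.hom_inv_id, Category.comp_id]

lemma roof_Q {X Y : Ct A t} (θ : (qis A t).Q.obj X ⟶ (qis A t).Q.obj Y) :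
    ∃ (B : Ct A t) (s : B ⟶ X) (_ : qis A t s) (a : B ⟶ Y),
      (qis A t).Q.map s ≫ θ = (qis A t).Q.map a := by
  have h : roofProp θ := by rw [roofProp_top]; trivial
  obtain ⟨B, Y', e, s, hs, a, h⟩ := h X (𝟙 _) ⟨X, X, rfl, 𝟙 X, (qis A t).id_mem _, 𝟙 X, by simp⟩
  obtain rfl := (Localization.Construction.objEquiv (qis A t)).injective e
  exact ⟨B, s, hs, a, by simpa using h⟩

lemma roof {E : Type*} [Category E] (L : Ct A t ⥤ E) [L.IsLocalization (qis A t)]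
    {X Y : Ct A t} (θ : L.obj X ⟶ L.obj Y) :
    ∃ (B : Ct A t) (s : B ⟶ X) (_ : qis A t s) (a : B ⟶ Y), L.map s ≫ θ = L.map a := by
  let F := (Localization.uniq (qis A t).Q L (qis A t)).functor
  let e : (qis A t).Q ⋙ F ≅ L := Localization.compUniqFunctor (qis A t).Q L (qis A t)
  obtain ⟨B, s, hs, a, h⟩ := roof_Q (F.preimage (e.hom.app X ≫ θ ≫ e.inv.app Y))
  refine ⟨B, s, hs, a, ?_⟩
  have h' := congrArg F.map h
  rw [F.map_comp, F.map_preimage] at h'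
  have n1 : F.map ((qis A t).Q.map s) ≫ e.hom.app X = e.hom.app B ≫ L.map s := e.hom.naturality s
  have n2 : F.map ((qis A t).Q.map a) ≫ e.hom.app Y = e.hom.app B ≫ L.map a := e.hom.naturality a
  rw [← cancel_epi (e.hom.app B), ← n2, ← h', ← reassoc_of% n1]
  simp

end Roof

section Step

open Abelian

variable {A : Type} [SmallCategory A] [Abelian A] {t : ℕ}

lemma ext_step [HasExt.{0} A] (hered : ∀ X Y : A, Subsingleton (Ext.{0} X Y 2))
    {P Z F : A} (d : P ⟶ Z) (z : Z ⟶ F) (w : d ≫ z = 0) (hex : (ShortComplex.mk d z w).Exact)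
    [Epi z] : ∃ (Y : A) (κ : P ⟶ Y) (p : Y ⟶ F) (w' : κ ≫ p = 0)
      (_ : (ShortComplex.mk κ p w').ShortExact) (η : Y ⟶ Z), κ ≫ η = d ∧ η ≫ z = p := by
  let e : P ⟶ kernel z := kernel.lift z d w
  have he : Epi e := hex.epi_kernelLift
  have h1 : (ShortComplex.mk (kernel.ι e) e (kernel.condition e)).ShortExact :=
    shortExact_of_lift _ _ _ (fun a ha => ⟨kernel.lift e a ha, kernel.lift_ι e a ha⟩)
  have h2 : (ShortComplex.mk (kernel.ι z) z (kernel.condition z)).ShortExact :=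
    shortExact_of_lift _ _ _ (fun a ha => ⟨kernel.lift z a ha, kernel.lift_ι z a ha⟩)
  have := hered F (kernel e)
  obtain ⟨y, hy⟩ := Ext.covariant_sequence_exact₃ F h1 h2.extClass (n₁ := 2) rfl
    (Subsingleton.elim (α := Ext.{0} F (kernel e) 2) _ _)
  replace hy : y.comp (Ext.mk₀ e) (add_zero 1) = h2.extClass := hy
  obtain ⟨Y, κ, p, w', h3, rfl⟩ := exists_ses y
  obtain ⟨m, hm1, hm2⟩ := exists_ses_map h3 h2 e (𝟙 F) (by rw [hy, Ext.mk₀_id_comp])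
  replace hm1 : κ ≫ m = e ≫ kernel.ι z := hm1
  replace hm2 : m ≫ z = p ≫ 𝟙 F := hm2
  refine ⟨Y, κ, p, w', h3, m, ?_, ?_⟩
  · rw [hm1, kernel.lift_ι]
  · rw [hm2, Category.comp_id]

lemma cyc_exact {f : ZMod t → A} {Q : Ct A t} (s : Q ⟶ mz f) (hs : qis A t s)
    (i j : ZMod t) (hij : i + 1 = j) :
    Epi (Q.iCycles j ≫ s.f j) ∧
      ∀ {T : A} (x : T ⟶ Q.cycles j), x ≫ Q.iCycles j ≫ s.f j = 0 →
      ∃ (T' : A) (π : T' ⟶ T) (_ : Epi π) (x₁ : T' ⟶ Q.X i), π ≫ x = x₁ ≫ Q.toCycles i j := by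
  have hq : QuasiIso s := hs
  have i1 : IsIso (HomologicalComplex.homologyMap s j) := by infer_instance
  have i2 : IsIso ((mz f).iCycles j) := (mz f).isIso_iCycles j (j + 1)
    ((pShape t).next_eq' (pRel j)) rfl
  have i3 : IsIso ((mz f).homologyπ j) := (mz f).isIso_homologyπ i j
    ((pShape t).prev_eq' hij) rfl
  have e1 := HomologicalComplex.homologyπ_naturality s j
  have e2 := HomologicalComplex.cyclesMap_i s j
  have e3 : Q.iCycles j ≫ s.f j = Q.homologyπ j ≫ HomologicalComplex.homologyMap s j ≫
      inv ((mz f).homologyπ j) ≫ (mz f).iCycles j := by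
    rw [← e2, reassoc_of% e1, IsIso.hom_inv_id_assoc]
  constructor
  · rw [e3]
    exact epi_comp _ _
  · intro T x hx
    rw [e3, ← Category.assoc] at hx
    have hx' : x ≫ Q.homologyπ j = 0 := by
      rw [← cancel_mono (HomologicalComplex.homologyMap s j ≫
        inv ((mz f).homologyπ j) ≫ (mz f).iCycles j), hx, zero_comp]
    have hex : (ShortComplex.mk _ _ (Q.toCycles_comp_homologyπ i j)).Exact :=
      ShortComplex.exact_of_g_is_cokernel _ (Q.homologyIsCokernel i j ((pShape t).prev_eq' hij))
    exact hex.exact_up_to_refinements x hx'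

lemma step [HasExt.{0} A] (hered : ∀ X Y : A, Subsingleton (Ext.{0} X Y 2))
    {f : ZMod t → A} {Q : Ct A t} (s : Q ⟶ mz f) (hs : qis A t s)
    (i j : ZMod t) (hij : i + 1 = j) :
    ∃ (Y : A) (κ : kernel (s.f i) ⟶ Y) (p : Y ⟶ f j) (w' : κ ≫ p = 0)
      (_ : (ShortComplex.mk κ p w').ShortExact) (η : Y ⟶ Q.X j),
      κ ≫ η = kernel.ι (s.f i) ≫ Q.d i j ∧ η ≫ Q.d j (j + 1) = 0 ∧ η ≫ s.f j = p := by
  obtain ⟨h1, h2⟩ := cyc_exact s hs i j hij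
  obtain ⟨h1', -⟩ := cyc_exact s hs (i - 1) i (by simp)
  have hd : Q.d i j ≫ s.f j = 0 := by
    rw [← s.comm i j, mz_d, comp_zero]
  let d : kernel (s.f i) ⟶ Q.cycles j := kernel.ι (s.f i) ≫ Q.toCycles i j
  have w : d ≫ Q.iCycles j ≫ s.f j = 0 := by
    simp only [d, Category.assoc, HomologicalComplex.toCycles_i_assoc, hd, comp_zero]
  have hex : (ShortComplex.mk d (Q.iCycles j ≫ s.f j) w).Exact := by
    rw [ShortComplex.exact_iff_exact_up_to_refinements]
    intro T x hx
    obtain ⟨T', π, hπ, x₁, hx₁⟩ := h2 x hx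
    obtain ⟨T'', π', hπ', y, hy⟩ := surjective_up_to_refinements_of_epi
      (Q.iCycles i ≫ s.f i) (x₁ ≫ s.f i)
    have hk : (π' ≫ x₁ - y ≫ Q.iCycles i) ≫ s.f i = 0 := by
      rw [Preadditive.sub_comp, Category.assoc, hy, Category.assoc, sub_self]
    refine ⟨T'', π' ≫ π, epi_comp _ _, kernel.lift _ _ hk, ?_⟩
    have e : Q.iCycles i ≫ Q.toCycles i j = 0 := by
      rw [← cancel_mono (Q.iCycles j), Category.assoc, Q.toCycles_i, zero_comp, Q.iCycles_d]
    change (π' ≫ π) ≫ x = kernel.lift _ _ hk ≫ kernel.ι (s.f i) ≫ Q.toCycles i j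
    rw [kernel.lift_ι_assoc, Preadditive.sub_comp, Category.assoc, hx₁, Category.assoc y, e,
      comp_zero, sub_zero, Category.assoc]
  obtain ⟨Y, κ, p, w', h3, η, h4, h5⟩ := ext_step hered d (Q.iCycles j ≫ s.f j) w hex
  refine ⟨Y, κ, p, w', h3, η ≫ Q.iCycles j, ?_, ?_, ?_⟩
  · rw [reassoc_of% h4, Category.assoc, Q.toCycles_i]
  · rw [Category.assoc, Q.iCycles_d, comp_zero]
  · rw [Category.assoc, h5]

lemma ker_eqToHom {f : ZMod t → A} {Q : Ct A t} (s : Q ⟶ mz f) (j k : ZMod t) (h : k = j)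
    (h' : Q.X k = Q.X j) : (kernel.ι (s.f k) ≫ eqToHom h') ≫ s.f j = 0 := by
  subst h; simp

lemma ker_eqToHom_d {f : ZMod t → A} {Q : Ct A t} (s : Q ⟶ mz f) (j k l : ZMod t) (h : k = j)
    (h' : Q.X k = Q.X j) : (kernel.ι (s.f k) ≫ eqToHom h') ≫ Q.d j l =
      kernel.ι (s.f k) ≫ Q.d k l := by
  subst h; simp

lemma mz_ses {K Y f : ZMod t → A} (κ : ∀ i, K i ⟶ Y i) (p : ∀ i, Y i ⟶ f i)
    (w : ∀ i, κ i ≫ p i = 0) (h : ∀ i, (ShortComplex.mk (κ i) (p i) (w i)).ShortExact) :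
    ∃ z : mzMap κ ≫ mzMap p = 0, (ShortComplex.mk (mzMap κ) (mzMap p) z).ShortExact := by
  refine ⟨HomologicalComplex.hom_ext _ _ (fun i => w i), ?_⟩
  apply HomologicalComplex.shortExact_of_degreewise_shortExact
  intro i
  have := h i
  exact this

lemma cover [HasExt.{0} A] (hered : ∀ X Y : A, Subsingleton (Ext.{0} X Y 2))
    {f : ZMod t → A} {Q : Ct A t} (s : Q ⟶ mz f) (hs : qis A t s) :
    ∃ (K Y : ZMod t → A) (κ : ∀ i, K i ⟶ Y i) (p : ∀ i, Y i ⟶ f i) (z : mzMap κ ≫ mzMap p = 0)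
      (_ : (ShortComplex.mk (mzMap κ) (mzMap p) z).ShortExact) (r : cone (mzMap κ) ⟶ Q),
      r ≫ s = coneS (mzMap κ) (mzMap p) z := by
  let K : ZMod t → A := fun j => kernel (s.f (j - 1))
  have H := fun j => step hered s hs (j - 1) j (by simp)
  choose Y κ p w h η h1 h2 h3 using H
  obtain ⟨z, hz⟩ := mz_ses (K := K) κ p w h
  let y : ∀ i, K (i + 1) ⟶ Q.X i := fun i => kernel.ι (s.f (i + 1 - 1)) ≫ eqToHom (by simp)
  let u : mz Y ⟶ Q := mkHom (mz Y) Q η (fun i => by rw [h2, mz_d, zero_comp])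
  have hu : mzMap κ ≫ u = discι K ≫ discDesc K Q y := by
    refine HomologicalComplex.hom_ext _ _ (forall_succ (fun i => ?_))
    refine (h1 (i + 1)).trans (Eq.trans ?_ (discDesc_inl K Q y i).symm)
    exact (ker_eqToHom_d s _ _ _ (by simp) _).symm
  refine ⟨K, Y, κ, p, z, hz, pushout.desc u (discDesc K Q y) hu, ?_⟩
  apply pushout.hom_ext
  · rw [pushout.inl_desc_assoc, coneL_S]
    exact HomologicalComplex.hom_ext _ _ (fun i => h3 i)
  · rw [pushout.inr_desc_assoc, coneR_S]
    apply disc_hom_ext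
    intro i
    rw [HomologicalComplex.comp_f, ← Category.assoc, discDesc_inr, HomologicalComplex.zero_f,
      comp_zero]
    exact ker_eqToHom s _ _ (by simp) _

end Step

section Surj

open Abelian

variable {A : Type} [SmallCategory A] [Abelian A] {t : ℕ}

lemma exists_unshift {P : ZMod t → Type} (β : ∀ i, P (i + 1)) :
    ∃ β₀ : ∀ i, P i, ∀ i, β₀ (i + 1) = β i := by
  refine ⟨fun i => (sub_add_cancel i 1) ▸ β (i - 1), fun i => ?_⟩
  have : ∀ (j : ZMod t) (_ : j = i) (h' : j + 1 = i + 1), (h' ▸ β j : P (i + 1)) = β i := by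
    intro j h h'; subst h; rfl
  exact this _ (by simp) _

lemma disc_to_mz {K h : ZMod t → A} (u : disc K ⟶ mz h) :
    ∃ β : ∀ i, K (i + 1) ⟶ h i, u = discπ K ≫ mzMap β := by
  refine ⟨fun i => (biprod.inr : K (i + 1) ⟶ K i ⊞ K (i + 1)) ≫ u.f i, ?_⟩
  apply disc_hom_ext
  intro i
  exact (biprod.inr_snd_assoc _).symm

variable {E : Type*} [Category E] [Preadditive E] (L : Ct A t ⥤ E) [L.Additive]
    [L.IsLocalization (qis A t)] [HasExt.{0} (Ct A t)]

/-- additive version of `phi` -/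
def phiHom (X : Ct A t) (g : ZMod t → A) :
    Ext.{0} X (mz g) 1 →+ (L.obj X ⟶ L.obj (mz (fun i => g (i + 1)))) :=
  AddMonoidHom.mk' (phi L) (phi_add L)

lemma phi_surj [HasExt.{0} A] (hered : ∀ X Y : A, Subsingleton (Ext.{0} X Y 2))
    (f g : ZMod t → A) : Function.Surjective (phiHom L (mz f) g) := by
  intro θ
  obtain ⟨Q, s, hs, a, hθ⟩ := roof L θ
  obtain ⟨K, Y, κ, p, z, hz, r, hr⟩ := cover hered s hs
  obtain ⟨b, hb⟩ : ∃ b, b = r ≫ a := ⟨_, rfl⟩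
  have hθ' : L.map (coneS (mzMap κ) (mzMap p) z) ≫ θ = L.map b := by
    rw [← hr, L.map_comp, Category.assoc, hθ, hb, L.map_comp]
  obtain ⟨β, hβ⟩ := disc_to_mz (coneR (mzMap κ) ≫ b)
  have h1 : mzMap κ ≫ coneL (mzMap κ) ≫ b = 0 := by
    rw [← Category.assoc, pushout.condition, Category.assoc, hβ, ← Category.assoc, disc_zero,
      zero_comp]
  obtain ⟨v, hv⟩ : ∃ v : mz f ⟶ mz (fun i => g (i + 1)), mzMap p ≫ v = coneL (mzMap κ) ≫ b :=
    ⟨_, (CokernelCofork.IsColimit.desc' hz.gIsCokernel _ h1).2⟩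
  have hb' : b = coneS (mzMap κ) (mzMap p) z ≫ v + coneC (mzMap κ) ≫ mzMap β := by
    apply pushout.hom_ext
    · rw [Preadditive.comp_add, ← Category.assoc, coneL_S, ← Category.assoc, coneL_C, zero_comp,
        add_zero, hv]
    · rw [Preadditive.comp_add, ← Category.assoc, coneR_S, ← Category.assoc, coneR_C, zero_comp,
        zero_add, hβ]
  obtain ⟨β₀, hβ₀⟩ := exists_unshift (P := fun i => K i ⟶ g i) β
  have hβ' : (fun i => β₀ (i + 1)) = β := funext hβ₀
  have := isIso_L L _ (coneS_qi _ _ z hz)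
  have e1 : θ = L.map v + δ L _ _ z hz ≫ L.map (mzMap β) := by
    rw [← cancel_epi (L.map (coneS (mzMap κ) (mzMap p) z)), hθ', hb', L.map_add,
      Preadditive.comp_add, ← Category.assoc, δ_spec, L.map_comp, L.map_comp]
  obtain ⟨x₁, hx₁⟩ : ∃ x : Ext.{0} (mz f) (mz g) 1,
    x = (Ext.mk₀ v).comp (disc_ses g).extClass (zero_add 1) := ⟨_, rfl⟩
  obtain ⟨x₂, hx₂⟩ : ∃ x : Ext.{0} (mz f) (mz g) 1,
    x = hz.extClass.comp (Ext.mk₀ (mzMap β₀)) (add_zero 1) := ⟨_, rfl⟩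
  have e2 : phiHom L (mz f) g x₁ = - L.map v := by
    rw [hx₁]
    refine (phi_pre L (g := g) _ v).trans ?_
    rw [phi_ses, δ_disc, Preadditive.comp_neg, Category.comp_id]
  have e3 : phiHom L (mz f) g x₂ = δ L _ _ z hz ≫ L.map (mzMap β) := by
    rw [hx₂]
    refine (phi_post L (g := K) (g' := g) _ β₀).trans ?_
    rw [phi_ses, hβ']
  refine ⟨- x₁ + x₂, ?_⟩
  rw [map_add, map_neg, e2, e3, neg_neg, e1]

end Surj

section Unwind

variable {A : Type} [SmallCategory A] [Abelian A] {t : ℕ}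

lemma castRel (n : ℤ) : (pShape t).Rel (n : ZMod t) ((n + 1 : ℤ) : ZMod t) := by
  change (n : ZMod t) + 1 = _
  push_cast
  rfl

/-- unwinding of a periodic complex -/
def uObj (X : Ct A t) : CochainComplex A ℤ where
  X n := X.X (n : ZMod t)
  d i j := if i + 1 = j then X.d (i : ZMod t) (j : ZMod t) else 0
  shape i j h := if_neg h
  d_comp_d' i j k _ _ := by
    split_ifs <;> simp

lemma uObj_d (X : Ct A t) (i j : ℤ) (h : i + 1 = j) :
    (uObj X).d i j = X.d (i : ZMod t) (j : ZMod t) := if_pos h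

/-- unwinding of a morphism -/
def uMap {X Y : Ct A t} (f : X ⟶ Y) : uObj X ⟶ uObj Y where
  f n := f.f (n : ZMod t)
  comm' i j h := by
    have h' : i + 1 = j := h
    rw [uObj_d _ _ _ h', uObj_d _ _ _ h']
    exact f.comm _ _

/-- unwinding functor -/
def U (A : Type) [SmallCategory A] [Abelian A] (t : ℕ) : Ct A t ⥤ CochainComplex A ℤ where
  obj := uObj
  map := uMap
  map_id _ := by ext n; rfl
  map_comp _ _ := by ext n; rfl

lemma uMap_comp {X Y Z : Ct A t} (f : X ⟶ Y) (g : Y ⟶ Z) : uMap (f ≫ g) = uMap f ≫ uMap g := by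
  ext n; rfl

lemma uMap_zero (X Y : Ct A t) : uMap (0 : X ⟶ Y) = 0 := by
  ext n; rfl

lemma u_ses {X Y Z : Ct A t} (f : X ⟶ Y) (g : Y ⟶ Z) (z : f ≫ g = 0)
    (h : (ShortComplex.mk f g z).ShortExact) :
    (ShortComplex.mk (uMap f) (uMap g)
      (by rw [← uMap_comp, z, uMap_zero])).ShortExact := by
  apply HomologicalComplex.shortExact_of_degreewise_shortExact
  intro n
  exact h.map_of_exact (HomologicalComplex.eval A (pShape t) (n : ZMod t))

lemma u_qi {X Y : Ct A t} (f : X ⟶ Y) (hf : HomologicalComplex.quasiIso A (pShape t) f) :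
    QuasiIso (uMap f) := by
  have hf' : QuasiIso f := hf
  rw [quasiIso_iff]
  intro n
  have h1 : (pShape t).prev (n : ZMod t) = ((n - 1 : ℤ) : ZMod t) :=
    (pShape t).prev_eq' (by have := castRel (t := t) (n - 1); rwa [sub_add_cancel] at this)
  have h2 : (pShape t).next (n : ZMod t) = ((n + 1 : ℤ) : ZMod t) :=
    (pShape t).next_eq' (castRel n)
  have key := (quasiIsoAt_iff' f _ _ _ h1 h2).1 inferInstance
  rw [quasiIsoAt_iff' (uMap f) (n - 1) n (n + 1) (by simp) (by simp)]
  let e' : ∀ W : Ct A t, ((HomologicalComplex.shortComplexFunctor' A (ComplexShape.up ℤ)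
      (n - 1) n (n + 1)).obj (uObj W)) ≅ ((HomologicalComplex.shortComplexFunctor' A (pShape t)
      ((n - 1 : ℤ) : ZMod t) (n : ZMod t) ((n + 1 : ℤ) : ZMod t)).obj W) := fun W =>
    ShortComplex.isoMk (Iso.refl _) (Iso.refl _) (Iso.refl _)
     ((Category.id_comp _).trans ((uObj_d W (n - 1) n (by ring)).symm.trans (Category.comp_id _).symm))
     ((Category.id_comp _).trans ((uObj_d W n (n + 1) rfl).symm.trans (Category.comp_id _).symm))
  refine (ShortComplex.quasiIso_iff_of_arrow_mk_iso _ _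
    (Arrow.isoMk (e' X) (e' Y) ?_)).2 key
  ext
  · exact (Category.id_comp _).trans (Category.comp_id _).symm
  · exact (Category.id_comp _).trans (Category.comp_id _).symm
  · exact (Category.id_comp _).trans (Category.comp_id _).symm

end Unwind

section Split
open HomologicalComplex

variable {A : Type} [SmallCategory A] [Abelian A]

lemma split_deg {G K N : CochainComplex A ℤ} (ι : G ⟶ K) (p : K ⟶ N) (z : ι ≫ p = 0)
    (h : (ShortComplex.mk ι p z).ShortExact) (n : ℤ)
    (hG : ∀ i j, G.d i j = 0) (hN : ∀ i j, N.d i j = 0)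
    (σ : ∀ n, N.homology n ⟶ K.homology n) (hσ : ∀ n, σ n ≫ homologyMap p n = 𝟙 _) :
    K.d n (n + 1) = 0 ∧ ∃ τ : N.X n ⟶ K.X n, τ ≫ p.f n = 𝟙 _ := by
  have hd : ∀ n, K.d n (n + 1) = 0 := by
    intro n
    have i1 : IsIso (N.iCycles n) := N.isIso_iCycles n (n + 1) (by simp) (hN _ _)
    have i2 : IsIso (N.homologyπ n) := N.isIso_homologyπ (n - 1) n (by simp) (hN _ _)
    have e1 : Epi (homologyMap p n) := by
      have : IsSplitEpi (homologyMap p n) := ⟨⟨σ n, hσ n⟩⟩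
      infer_instance
    have e2 : Epi (cyclesMap p n) := by
      have : Epi (cyclesMap p n ≫ N.homologyπ n) := by
        rw [← homologyπ_naturality]; infer_instance
      have h3 : cyclesMap p n = (cyclesMap p n ≫ N.homologyπ n) ≫ inv (N.homologyπ n) := by simp
      rw [h3]; infer_instance
    have e3 : Epi (K.iCycles n ≫ p.f n) := by
      rw [← cyclesMap_i]; infer_instance
    have hιd : ι.f n ≫ K.d n (n + 1) = 0 := by rw [ι.comm, hG, zero_comp]
    have hn : (ShortComplex.mk (ι.f n) (p.f n) (by rw [← comp_f, z]; rfl)).ShortExact :=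
      h.map_of_exact (HomologicalComplex.eval A _ n)
    obtain ⟨b, hb⟩ := CokernelCofork.IsColimit.desc' hn.gIsCokernel _ hιd
    have hb' : p.f n ≫ b = K.d n (n + 1) := hb
    have : b = 0 := by
      rw [← cancel_epi (K.iCycles n ≫ p.f n), Category.assoc, hb', comp_zero, iCycles_d]
    rw [← hb', this, comp_zero]
  refine ⟨hd n, ?_⟩
  have i1 : IsIso (N.iCycles n) := N.isIso_iCycles n (n + 1) (by simp) (hN _ _)
  have i2 : IsIso (K.homologyπ n) := K.isIso_homologyπ (n - 1) n (by simp)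
    (by have := hd (n - 1); rwa [sub_add_cancel] at this)
  refine ⟨inv (N.iCycles n) ≫ N.homologyπ n ≫ σ n ≫ inv (K.homologyπ n) ≫ K.iCycles n, ?_⟩
  have i3 : IsIso (N.homologyπ n) := N.isIso_homologyπ (n - 1) n (by simp) (hN _ _)
  have hh : cyclesMap p n = K.homologyπ n ≫ homologyMap p n ≫ inv (N.homologyπ n) := by
    rw [← Category.assoc, homologyπ_naturality]; simp
  simp only [Category.assoc]
  rw [← cyclesMap_i, hh]
  simp only [Category.assoc, IsIso.inv_hom_id_assoc]
  rw [reassoc_of% (hσ n)]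
  simp

end Split

section Inj

open Abelian HomologicalComplex

variable {A : Type} [SmallCategory A] [Abelian A] {t : ℕ}
  {E : Type*} [Category E] [Preadditive E] (L : Ct A t ⥤ E) [L.Additive]
    [L.IsLocalization (qis A t)] [HasExt.{0} (Ct A t)]

lemma inv_eq_zero_of_L {F : Type*} [Category F] (G : Ct A t ⥤ F) (hG : (qis A t).IsInvertedBy G)
    {X Y : Ct A t} (c c' : X ⟶ Y) (hc : L.map c = L.map c') : G.map c = G.map c' := by
  have : Localization.Lifting L (qis A t) G (Localization.lift G hG L) :=
    Localization.liftingLift G hG L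
  let e := Localization.fac G hG L
  rw [← cancel_epi (e.hom.app X), ← e.hom.naturality, ← e.hom.naturality, Functor.comp_map,
    Functor.comp_map, hc]

lemma homology_section {g : ZMod t → A} {M X : Ct A t} (ι : mz g ⟶ M) (p : M ⟶ X)
    (z : ι ≫ p = 0) (h : (ShortComplex.mk ι p z).ShortExact) (h0 : δ L ι p z h = 0) (n : ℤ) :
    ∃ σ : (uObj X).homology n ⟶ (uObj M).homology n, σ ≫ homologyMap (uMap p) n = 𝟙 _ := by
  let _ := HasDerivedCategory.standard A
  have hc : L.map (coneC ι) = L.map 0 := by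
    rw [← δ_spec L ι p z h, h0, comp_zero, L.map_zero]
  have hG : (qis A t).IsInvertedBy (U A t ⋙ DerivedCategory.Q (C := A)) := by
    intro X Y f hf
    exact (DerivedCategory.isIso_Q_map_iff_quasiIso A (uMap f)).2 (u_qi f hf)
  have h1 : DerivedCategory.Q.map (uMap (coneC ι)) = 0 := by
    refine (inv_eq_zero_of_L L _ hG _ _ hc).trans ?_
    change DerivedCategory.Q.map (uMap (0 : cone ι ⟶ mz (fun i => g (i + 1)))) = 0
    rw [uMap_zero, Functor.map_zero]
  have hm : Mono ι := h.mono_f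
  have hT := DerivedCategory.triangleOfSES_distinguished
    (u_ses _ _ (coneL_C ι) (cone_ses' ι hm))
  obtain ⟨σ, hσ⟩ : ∃ b, 𝟙 (DerivedCategory.Q.obj (uObj (cone ι))) =
      b ≫ DerivedCategory.Q.map (uMap (coneL ι)) :=
    tri_co₂ hT (𝟙 _) ((Category.id_comp _).trans h1)
  have i1 : IsIso (DerivedCategory.Q.map (uMap (coneS ι p z))) :=
    (DerivedCategory.isIso_Q_map_iff_quasiIso A _).2 (u_qi _ (coneS_qi ι p z h))
  have h2 : (inv (DerivedCategory.Q.map (uMap (coneS ι p z))) ≫ σ) ≫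
      DerivedCategory.Q.map (uMap p) = 𝟙 _ := by
    have : uMap p = uMap (coneL ι) ≫ uMap (coneS ι p z) := by rw [← uMap_comp, coneL_S]
    rw [this, Functor.map_comp, Category.assoc, ← Category.assoc σ, ← hσ, Category.id_comp,
      IsIso.inv_hom_id]
  obtain ⟨s, hs⟩ : ∃ s : DerivedCategory.Q.obj (uObj X) ⟶ DerivedCategory.Q.obj (uObj M),
    s ≫ DerivedCategory.Q.map (uMap p) = 𝟙 _ := ⟨_, h2⟩
  let e := DerivedCategory.homologyFunctorFactors A n
  refine ⟨e.inv.app (uObj X) ≫ (DerivedCategory.homologyFunctor A n).map s ≫ e.hom.app (uObj M), ?_⟩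
  have h3 := DerivedCategory.homologyFunctorFactors_hom_naturality (uMap p) n
  refine (Category.assoc _ _ _).trans ?_
  refine (congrArg (e.inv.app (uObj X) ≫ ·) ((Category.assoc _ _ _).trans
    (congrArg ((DerivedCategory.homologyFunctor A n).map s ≫ ·) h3.symm))).trans ?_
  have h4 : (DerivedCategory.homologyFunctor A n).map s ≫
    (DerivedCategory.homologyFunctor A n).map (DerivedCategory.Q.map (uMap p)) = 𝟙 _ := by
    rw [← Functor.map_comp, hs, CategoryTheory.Functor.map_id]
  refine (congrArg (e.inv.app (uObj X) ≫ ·) ((Category.assoc _ _ _).symm.trans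
    ((congrArg (· ≫ e.hom.app (uObj X)) h4).trans (Category.id_comp _)))).trans ?_
  exact e.inv_hom_id_app _

lemma phi_inj (f g : ZMod t → A) : Function.Injective (phiHom L (mz f) g) := by
  rw [injective_iff_map_eq_zero]
  intro x hx
  obtain ⟨M, ι, p, z, h, h1, h2⟩ := phi_exists L x
  have h0 : δ L ι p z h = 0 := h2.symm.trans hx
  choose σ hσ using homology_section L ι p z h h0
  have key := fun n => split_deg (uMap ι) (uMap p) _ (u_ses ι p z h) n
    (fun i j => by dsimp only [uObj]; exact ite_self _)
    (fun i j => by dsimp only [uObj]; exact ite_self _) σ hσ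
  have key' : ∀ i : ZMod t, M.d i (i + 1) = 0 ∧ ∃ τ : f i ⟶ M.X i, τ ≫ p.f i = 𝟙 _ := by
    intro i
    obtain ⟨n, rfl⟩ := ZMod.intCast_surjective i
    refine ⟨?_, (key n).2⟩
    have h3 : M.d (n : ZMod t) ((n + 1 : ℤ) : ZMod t) = 0 :=
      (uObj_d M n (n + 1) rfl).symm.trans (key n).1
    have : ((n + 1 : ℤ) : ZMod t) = (n : ZMod t) + 1 := by push_cast; rfl
    rwa [this] at h3
  choose hd τ hτ using key'
  let s : mz f ⟶ M := mkHom (mz f) M τ (fun i => by rw [hd, mz_d, comp_zero, zero_comp])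
  have hs : s ≫ p = 𝟙 (mz f) := by
    ext i
    exact hτ i
  rw [← h1, ← Ext.mk₀_id_comp h.extClass]
  have h5 : (Ext.mk₀ (𝟙 (mz f)) : Ext.{0} (mz f) (mz f) 0) =
    (Ext.mk₀ s).comp (Ext.mk₀ p) (zero_add 0) := by rw [Ext.mk₀_comp_mk₀, hs]
  have h6 := h.comp_extClass
  have h7 : ((Ext.mk₀ s).comp (Ext.mk₀ p) (zero_add 0)).comp h.extClass (zero_add 1) = 0 := by
    rw [Ext.comp_assoc (Ext.mk₀ s) (Ext.mk₀ p) h.extClass (zero_add 0) (zero_add 1) (by simp)]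
    exact (congrArg (fun y => (Ext.mk₀ s).comp y (zero_add 1)) h6).trans (Ext.comp_zero _ _ _ _ _)
  exact (congrArg (fun y => Ext.comp y h.extClass (zero_add 1)) h5).trans h7

lemma main_mz [HasExt.{0} A] (hered : ∀ X Y : A, Subsingleton (Ext.{0} X Y 2))
    (f g : ZMod t → A) : Nonempty (Ext.{0} (mz f) (mz g) 1 ≃+
        (L.obj (mz f) ⟶ L.obj (mz (fun j => g (j + 1))))) :=
  ⟨AddEquiv.ofBijective (phiHom L (mz f) g) ⟨phi_inj L f g, phi_surj L hered f g⟩⟩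

end Inj

theorem ext_iso_hom_in_relative_derived_category
    (A : Type) [SmallCategory A] [Abelian A] [HasExt.{0} A]
    -- hereditary: Ext² vanishes identically
    (hered : ∀ X Y : A, Subsingleton (Abelian.Ext X Y 2))
    (t : ℕ) (htpos : 1 ≤ t)
    [HasExt.{0} (Ct A t)]
    (E : Type*) [Category E] [Preadditive E] (L : Ct A t ⥤ E) [L.Additive]
    [L.IsLocalization (HomologicalComplex.quasiIso A (pShape t))]
    (f g : ZMod t → A) :
    Nonempty
      (Abelian.Ext (mkZero f) (mkZero g) 1 ≃+
        (L.obj (mkZero f) ⟶ L.obj (mkZero (fun j => g (j + 1))))) := by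
  exact main_mz L hered f g

end GreenDH
end
end

section
/- Let A be a finitary hereditary abelian category over a finite field and t an odd positive integer. For t-periodic complexes A_1^• = (A_1^i, 0)_{i∈Z_t} and A_2^• = (A_2^i, 0)_{i∈Z_t} with zero differentials, one has ∏_{i=0}^{t-1} |Hom_{D_t(A)}(A_1^•[i], A_2^•)|^{(-1)^i} = ∏_{i=0}^{t-1} |Hom_A(A_1^i, A_2^i)| · |Ext^1_A(A_1^i, A_2^i)| · ∏_{k=1}^{t-1} ⟨A_1^{i+k}, A_2^i⟩^{(-1)^k}. -/
/-!
STATEMENT 14.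
For a finitary hereditary abelian category `A` over a finite field, an odd positive
integer `t`, and `t`-periodic complexes `A₁^• = (f, 0)`, `A₂^• = (g, 0)` with zero
differentials,
`∏_{i=0}^{t-1} |Hom_{D_t(A)}(A₁^•[i], A₂^•)|^{(-1)^i}
  = ∏_{i=0}^{t-1} |Hom(A₁^i, A₂^i)| · |Ext¹(A₁^i, A₂^i)| · ∏_{k=1}^{t-1} ⟨A₁^{i+k}, A₂^i⟩^{(-1)^k}`.
`D_t(A)` is encoded as any localization `L : C_t(A) ⥤ E` at the quasi-isomorphisms; the
shift `A₁^•[i]` of a complex with zero differentials has components `j ↦ f (j + i)`.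
-/

open CategoryTheory CategoryTheory.Limits

noncomputable section

namespace GreenDH

def homCard {C : Type*} [Category C] (X Y : C) : ℕ := Nat.card (X ⟶ Y)

def ext1Card {A : Type} [SmallCategory A] [Abelian A] [HasExt.{0} A] (X Y : A) : ℕ :=
  Nat.card (Abelian.Ext X Y 1)

/-- The multiplicative Euler form `⟨X, Y⟩ = |Hom(X,Y)| / |Ext¹(X,Y)|`. -/
def euler {A : Type} [SmallCategory A] [Abelian A] [HasExt.{0} A] (X Y : A) : ℚ :=
  (homCard X Y : ℚ) / (ext1Card X Y : ℚ)

open DerivedCategory Pretriangulated in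
lemma exists_ses_s14 {A : Type} [SmallCategory A] [Abelian A] [HasExt.{0} A] {X Y : A}
    (ε : Abelian.Ext X Y 1) :
    ∃ (E : A) (i : Y ⟶ E) (p : E ⟶ X) (w : i ≫ p = 0)
      (hS : (ShortComplex.mk i p w).ShortExact), hS.extClass = ε := by
  let := HasDerivedCategory.standard A
  obtain ⟨Z, a, b, hT⟩ := distinguished_cocone_triangle₂ (ε.hom)
  have hGE : Z.IsGE 0 := by
    rw [isGE_iff]
    intro n hn
    exact (HomologySequence.exact₂ _ hT n).isZero_of_both_zeros
      ((isZero_of_isGE ((singleFunctor A 0).obj Y) 0 n hn).eq_of_src _ _) ((isZero_of_isGE ((singleFunctor A 0).obj X) 0 n hn).eq_of_tgt _ _)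
  have hLE : Z.IsLE 0 := by
    rw [isLE_iff]
    intro n hn
    exact (HomologySequence.exact₂ _ hT n).isZero_of_both_zeros
      ((isZero_of_isLE ((singleFunctor A 0).obj Y) 0 n hn).eq_of_src _ _) ((isZero_of_isLE ((singleFunctor A 0).obj X) 0 n hn).eq_of_tgt _ _)
  obtain ⟨E, ⟨e⟩⟩ := exists_iso_singleFunctor_obj_of_isGE_of_isLE Z 0
  obtain ⟨i, hi⟩ := (singleFunctor A 0).map_surjective (a ≫ e.hom)
  obtain ⟨p, hp⟩ := (singleFunctor A 0).map_surjective (e.inv ≫ b)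
  have hT' : Triangle.mk ((singleFunctor A 0).map i) ((singleFunctor A 0).map p) ε.hom ∈
      distTriang _ := by
    refine isomorphic_distinguished _ hT _ ?_
    refine Triangle.isoMk _ _ (Iso.refl _) e.symm (Iso.refl _) ?_ ?_ ?_
    · change (singleFunctor A 0).map i ≫ e.inv = 𝟙 _ ≫ a
      rw [hi]; simp
    · change (singleFunctor A 0).map p ≫ 𝟙 _ = e.inv ≫ b
      rw [hp]; simp
    · change ε.hom ≫ (shiftFunctor (DerivedCategory A) (1 : ℤ)).map (𝟙 _) = 𝟙 _ ≫ ε.hom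
      rw [CategoryTheory.Functor.map_id, Category.id_comp]
      exact Category.comp_id (X := (singleFunctor A 0).obj X) _
  have w : i ≫ p = 0 := (singleFunctor A 0).map_injective (by
    rw [Functor.map_comp, Functor.map_zero]
    exact comp_distTriang_mor_zero₁₂ _ hT')
  have hS : (ShortComplex.mk i p w).ShortExact := by
    let α := singleFunctorCompHomologyFunctorIso A 0
    have h₂ := HomologySequence.exact₂ _ hT' 0
    have hm := (HomologySequence.mono_homologyMap_mor₁_iff _ hT' (-1) 0 (by lia)).2
      ((isZero_of_isGE ((singleFunctor A 0).obj X) 0 (-1) (by lia)).eq_of_src _ _)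
    have he := (HomologySequence.epi_homologyMap_mor₂_iff _ hT' 0 1 (by lia)).2
      ((isZero_of_isLE ((singleFunctor A 0).obj Y) 0 1 (by lia)).eq_of_tgt _ _)
    refine ShortComplex.ShortExact.mk' ?_ ?_ ?_
    · refine ShortComplex.exact_of_iso ?_ h₂
      exact ShortComplex.isoMk (α.app _) (α.app _) (α.app _) (α.hom.naturality i).symm
        (α.hom.naturality p).symm
    · exact ((MorphismProperty.monomorphisms A).arrow_mk_iso_iff
        (Arrow.isoMk (α.app _) (α.app _) (α.hom.naturality i).symm)).1 hm
    · exact ((MorphismProperty.epimorphisms A).arrow_mk_iso_iff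
        (Arrow.isoMk (α.app _) (α.app _) (α.hom.naturality p).symm)).1 he
  refine ⟨E, i, p, w, hS, ?_⟩
  ext
  rw [ShortComplex.ShortExact.extClass_hom]
  obtain ⟨c, hc1, hc2⟩ := complete_distinguished_triangle_morphism _ _
    hS.singleTriangle_distinguished hT' (𝟙 _) (𝟙 _)
    ((Category.comp_id ((singleFunctor A 0).map i)).trans (Category.id_comp _).symm)
  obtain ⟨c, rfl⟩ := (singleFunctor A 0).map_surjective c
  change (singleFunctor A 0).map p ≫ (singleFunctor A 0).map c = 𝟙 _ ≫ (singleFunctor A 0).map p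
    at hc1
  change hS.singleδ ≫ (shiftFunctor (DerivedCategory A) (1 : ℤ)).map (𝟙 _) =
    (singleFunctor A 0).map c ≫ ε.hom at hc2
  have := hS.epi_g
  dsimp at this
  have hc : c = 𝟙 X := by
    rw [← cancel_epi p]
    apply (singleFunctor A 0).map_injective
    simpa using hc1
  subst hc
  rwa [CategoryTheory.Functor.map_id, CategoryTheory.Functor.map_id, Category.id_comp, Category.comp_id] at hc2

lemma ses_map {A : Type} [SmallCategory A] [Abelian A] [HasExt.{0} A] {N E F G E' : A}
    {i : N ⟶ E} {p : E ⟶ F} {w : i ≫ p = 0} (hS : (ShortComplex.mk i p w).ShortExact)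
    {i' : G ⟶ E'} {p' : E' ⟶ F} {w' : i' ≫ p' = 0} (hS' : (ShortComplex.mk i' p' w').ShortExact)
    (b : N ⟶ G) (h : hS.extClass.comp (Abelian.Ext.mk₀ b) (add_zero 1) = hS'.extClass) :
    ∃ c : E ⟶ E', i ≫ c = b ≫ i' ∧ c ≫ p' = p := by
  obtain ⟨x, hx⟩ := Abelian.Ext.covariant_sequence_exact₃ (X := E) hS' (Abelian.Ext.mk₀ p)
    (hn₁ := zero_add 1) (by
      erw [← h, hS.comp_extClass_assoc])
  obtain ⟨c, rfl⟩ := (Abelian.Ext.mk₀_bijective _ _).2 x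
  have hc : c ≫ p' = p := by
    rw [Abelian.Ext.mk₀_comp_mk₀] at hx
    exact (Abelian.Ext.mk₀_bijective _ _).1 hx
  have := hS'.mono_f
  dsimp at this
  let b' : N ⟶ G := hS'.exact.lift (i ≫ c) (by simp [hc, w])
  have hb' : b' ≫ i' = i ≫ c := hS'.exact.lift_f _ _
  have hnat := ShortComplex.ShortExact.extClass_naturality hS hS'
    { τ₁ := b', τ₂ := c, τ₃ := 𝟙 F, comm₁₂ := hb', comm₂₃ := by simp [hc] }
  dsimp at hnat
  rw [Abelian.Ext.mk₀_id_comp, ← h] at hnat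
  obtain ⟨x, hx⟩ := Abelian.Ext.contravariant_sequence_exact₁ (Y := G) hS
    (Abelian.Ext.mk₀ (b' - b)) (hn₁ := add_zero 1) (by
      rw [sub_eq_add_neg, Abelian.Ext.mk₀_add, Abelian.Ext.mk₀_neg, Abelian.Ext.comp_add, hnat,
        Abelian.Ext.comp_neg, add_neg_cancel])
  obtain ⟨e, rfl⟩ := (Abelian.Ext.mk₀_bijective _ _).2 x
  rw [Abelian.Ext.mk₀_comp_mk₀] at hx
  have he : i ≫ e = b' - b := (Abelian.Ext.mk₀_bijective _ _).1 hx
  refine ⟨c - e ≫ i', ?_, ?_⟩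
  · rw [Preadditive.comp_sub, ← hb', ← Category.assoc, he]; simp
  · simp [hc, w']

lemma ses_lift {A : Type} [SmallCategory A] [Abelian A] [HasExt.{0} A]
    (hered : ∀ X Y : A, Subsingleton (Abelian.Ext X Y 2)) {M B Z F : A}
    {i : B ⟶ Z} {p : Z ⟶ F} {w : i ≫ p = 0} (hS : (ShortComplex.mk i p w).ShortExact)
    (π : M ⟶ B) [Epi π] :
    ∃ (E : A) (j : M ⟶ E) (q : E ⟶ F) (w' : j ≫ q = 0)
      (_ : (ShortComplex.mk j q w').ShortExact) (c : E ⟶ Z), j ≫ c = π ≫ i ∧ c ≫ p = q := by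
  have hK : (ShortComplex.mk (kernel.ι π) π (kernel.condition π)).ShortExact :=
    { exact := ShortComplex.exact_of_f_is_kernel _ (kernelIsKernel π)
      mono_f := by dsimp; infer_instance
      epi_g := by dsimp; infer_instance }
  obtain ⟨x, hx⟩ := Abelian.Ext.covariant_sequence_exact₃ (X := F) hK hS.extClass
    (hn₁ := rfl) ((hered _ _).elim _ _)
  obtain ⟨E, j, q, w', hE, rfl⟩ := exists_ses_s14 x
  obtain ⟨c, h1, h2⟩ := ses_map hE hS π hx
  exact ⟨E, j, q, w', hE, c, h1, h2⟩



lemma roof_Q_s14 {C : Type*} [Category C] (W : MorphismProperty C) [W.IsMultiplicative]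
    (ore : ∀ ⦃X Y Y' : C⦄ (f : X ⟶ Y) (s : Y' ⟶ Y), W s →
      ∃ (X' : C) (s' : X' ⟶ X) (f' : X' ⟶ Y'), W s' ∧
        W.Q.map f' ≫ W.Q.map s = W.Q.map s' ≫ W.Q.map f)
    {X Y : C} (u : W.Q.obj X ⟶ W.Q.obj Y) :
    ∃ (X' : C) (s : X' ⟶ X) (m : X' ⟶ Y), W s ∧ W.Q.map s ≫ u = W.Q.map m := by
  let P : MorphismProperty W.Localization := fun a b u =>
    ∀ (X Y : C) (ha : W.Q.obj X = a) (hb : W.Q.obj Y = b),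
    ∃ (X' : C) (s : X' ⟶ X) (m : X' ⟶ Y),
      W s ∧ W.Q.map s ≫ eqToHom ha ≫ u ≫ eqToHom hb.symm = W.Q.map m
  have inj : ∀ X Y : C, W.Q.obj X = W.Q.obj Y → X = Y := fun X Y h =>
    (Localization.Construction.objEquiv W).injective h
  have : P.IsStableUnderComposition := ⟨by
    intro a b c u v hu hv X Z ha hc
    obtain ⟨Y, hb⟩ : ∃ Y, W.Q.obj Y = b := (Localization.Construction.objEquiv W).surjective b
    subst ha hb hc
    obtain ⟨X₁, s₁, m₁, hs₁, h₁⟩ := hu X Y rfl rfl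
    obtain ⟨X₂, s₂, m₂, hs₂, h₂⟩ := hv Y Z rfl rfl
    obtain ⟨X₃, s₃, m₃, hs₃, h₃⟩ := ore m₁ s₂ hs₂
    refine ⟨X₃, s₃ ≫ s₁, m₃ ≫ m₂, W.comp_mem _ _ hs₃ hs₁, ?_⟩
    simp only [eqToHom_refl, Category.id_comp, Category.comp_id] at h₁ h₂ ⊢
    simp only [Functor.map_comp, Category.assoc]
    rw [← h₂, reassoc_of% h₃, ← h₁, Category.assoc]⟩
  have hP := Localization.Construction.morphismProperty_eq_top P
    (fun X Y f X' Y' ha hb => by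
      obtain rfl := inj _ _ ha
      obtain rfl := inj _ _ hb
      exact ⟨X', 𝟙 X', f, W.id_mem X', by simp⟩)
    (fun X Y w hw X' Y' ha hb => by
      obtain rfl := inj _ _ ha
      obtain rfl := inj _ _ hb
      refine ⟨Y', w, 𝟙 Y', hw, ?_⟩
      simp only [eqToHom_refl, Category.id_comp, Category.comp_id, CategoryTheory.Functor.map_id]
      exact (Localization.Construction.wIso w hw).hom_inv_id)
  have hu : P u := by rw [hP]; trivial
  simpa using hu X Y rfl rfl

lemma roof_s14 {C : Type*} [Category C] (W : MorphismProperty C) [W.IsMultiplicative]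
    (ore : ∀ ⦃X Y Y' : C⦄ (f : X ⟶ Y) (s : Y' ⟶ Y), W s →
      ∃ (X' : C) (s' : X' ⟶ X) (f' : X' ⟶ Y'), W s' ∧
        W.Q.map f' ≫ W.Q.map s = W.Q.map s' ≫ W.Q.map f)
    {E : Type*} [Category E] (L : C ⥤ E) [L.IsLocalization W]
    {X Y : C} (u : L.obj X ⟶ L.obj Y) :
    ∃ (X' : C) (s : X' ⟶ X) (m : X' ⟶ Y), W s ∧ L.map s ≫ u = L.map m := by
  obtain ⟨X', s, m, hs, h⟩ := roof_Q_s14 W ore (Localization.homEquiv W L W.Q u)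
  refine ⟨X', s, m, hs, ?_⟩
  apply (Localization.homEquiv W L W.Q).injective
  rw [Localization.homEquiv_comp, Localization.homEquiv_map, h, Localization.homEquiv_map]

section
variable {A : Type} [SmallCategory A] [Abelian A] {t : ℕ}

/-- A reducible version of `mkZero`. -/
@[reducible] def mkZ (f : ZMod t → A) : Ct A t where
  X := f
  d _ _ := 0
  shape _ _ _ := rfl
  d_comp_d' := by intros; simp

lemma quasiIso_g {S : ShortComplex (Ct A t)} (hS : S.ShortExact) (h : S.X₁.Acyclic) :
    QuasiIso S.g := by
  refine ⟨fun i => ?_⟩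
  rw [quasiIsoAt_iff_isIso_homologyMap]
  have h₁ : Mono (HomologicalComplex.homologyMap S.g i) :=
    (hS.homology_exact₂ i).mono_g ((h i).isZero_homology.eq_of_src _ _)
  have h₂ : Epi (HomologicalComplex.homologyMap S.g i) :=
    (hS.homology_exact₃ i (i + 1) rfl).epi_f ((h (i + 1)).isZero_homology.eq_of_tgt _ _)
  exact isIso_of_mono_of_epi _

def twd {N E : ZMod t → A} (ι : ∀ i, N i ⟶ E i) (i j : ZMod t) :
    E i ⊞ N (i + 1) ⟶ E j ⊞ N (j + 1) :=
  if h : i + 1 = j then biprod.snd ≫ ι (i + 1) ≫ eqToHom (by rw [h]) ≫ biprod.inl else 0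

lemma twd_eq {N E : ZMod t → A} (ι : ∀ i, N i ⟶ E i) (i : ZMod t) :
    twd ι i (i + 1) = biprod.snd ≫ ι (i + 1) ≫ biprod.inl := by
  simp [twd]

/-- The complex `E i ⊞ N (i+1)` with differential `ι`. -/
@[reducible] def tw {N E : ZMod t → A} (ι : ∀ i, N i ⟶ E i) : Ct A t where
  X i := E i ⊞ N (i + 1)
  d i j := twd ι i j
  shape i j h := dif_neg h
  d_comp_d' := by
    rintro i _ _ rfl rfl
    erw [twd_eq, twd_eq]
    simp

def twDesc {N E : ZMod t → A} (ι : ∀ i, N i ⟶ E i) (K : Ct A t) (a : ∀ i, E i ⟶ K.X i)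
    (b : ∀ i, N (i + 1) ⟶ K.X i) (ha : ∀ i, a i ≫ K.d i (i + 1) = 0)
    (hb : ∀ i, b i ≫ K.d i (i + 1) = ι (i + 1) ≫ a (i + 1)) : tw ι ⟶ K where
  f i := biprod.desc (a i) (b i)
  comm' := by
    rintro i _ rfl
    change biprod.desc (a i) (b i) ≫ K.d i (i + 1) = twd ι i (i + 1) ≫ biprod.desc (a (i + 1)) (b (i + 1))
    rw [twd_eq]
    apply biprod.hom_ext'
    · simp [ha]
    · simp [hb]

lemma twDesc_f {N E : ZMod t → A} (ι : ∀ i, N i ⟶ E i) (K : Ct A t) (a : ∀ i, E i ⟶ K.X i)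
    (b : ∀ i, N (i + 1) ⟶ K.X i) (ha : ∀ i, a i ≫ K.d i (i + 1) = 0)
    (hb : ∀ i, b i ≫ K.d i (i + 1) = ι (i + 1) ≫ a (i + 1)) (i : ZMod t) :
    (twDesc ι K a b ha hb).f i = biprod.desc (a i) (b i) := rfl

lemma tw_id_acyclic (N : ZMod t → A) : (tw (fun i => 𝟙 (N i))).Acyclic := by
  intro i
  obtain ⟨j, rfl⟩ : ∃ j, i = j + 1 := ⟨i - 1, by ring⟩
  rw [HomologicalComplex.exactAt_iff' _ j (j + 1) (j + 1 + 1)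
    ((pShape t).prev_eq' rfl) ((pShape t).next_eq' rfl)]
  rw [ShortComplex.exact_iff_exact_up_to_refinements]
  intro B x hx
  change B ⟶ N (j + 1) ⊞ N (j + 1 + 1) at x
  change x ≫ twd (fun i => 𝟙 (N i)) (j + 1) (j + 1 + 1) = 0 at hx
  refine ⟨B, 𝟙 B, inferInstance, (x ≫ biprod.fst) ≫ biprod.inr, ?_⟩
  change 𝟙 B ≫ x = ((x ≫ biprod.fst) ≫ biprod.inr) ≫ twd (fun i => 𝟙 (N i)) j (j + 1)
  rw [twd_eq] at hx ⊢
  have hx' : x ≫ biprod.snd = 0 := by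
    have := congrArg (fun y => y ≫ biprod.fst) hx
    simpa using this
  apply biprod.hom_ext
  · simp
  · simp [hx']

lemma tw_ses {N E F : ZMod t → A} {ι : ∀ i, N i ⟶ E i} {p : ∀ i, E i ⟶ F i}
    {w : ∀ i, ι i ≫ p i = 0} (h : ∀ i, (ShortComplex.mk (ι i) (p i) (w i)).ShortExact)
    (ha : ∀ i, p i ≫ (mkZ F).d i (i + 1) = 0)
    (hb : ∀ i, 0 ≫ (mkZ F).d i (i + 1) = ι (i + 1) ≫ p (i + 1)) :
    QuasiIso (twDesc ι (mkZ F) p (fun i => 0) ha hb) := by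
  let k : tw (fun i => 𝟙 (N i)) ⟶ tw ι := twDesc _ _ (fun i => ι i ≫ biprod.inl)
    (fun i => biprod.inr) (fun i => by dsimp only; rw [twd_eq]; simp)
      (fun i => by dsimp only; rw [twd_eq]; simp)
  have hk : k ≫ twDesc ι (mkZ F) p (fun i => 0) ha hb = 0 := by
    refine HomologicalComplex.hom_ext _ _ fun i => ?_
    change biprod.desc (ι i ≫ biprod.inl) biprod.inr ≫ biprod.desc (p i) 0 = 0
    apply biprod.hom_ext'
    · simp [w]
    · simp
  have hS : (ShortComplex.mk k _ hk).ShortExact := by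
    apply HomologicalComplex.shortExact_of_degreewise_shortExact
    intro i
    have hm := (h i).mono_f
    have he := (h i).epi_g
    have hex := (h i).exact
    dsimp at hm he
    have e : (biprod.desc (ι i ≫ biprod.inl) biprod.inr : N i ⊞ N (i + 1) ⟶ E i ⊞ N (i + 1)) ≫
        biprod.desc (p i) 0 = 0 := by
      apply biprod.hom_ext' <;> simp [w]
    change (ShortComplex.mk (biprod.desc (ι i ≫ biprod.inl) biprod.inr :
      N i ⊞ N (i + 1) ⟶ E i ⊞ N (i + 1)) (biprod.desc (p i) 0) e).ShortExact
    refine ShortComplex.ShortExact.mk' ?_ ?_ ?_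
    · rw [ShortComplex.exact_iff_exact_up_to_refinements] at hex ⊢
      intro B x hx
      dsimp at x hx
      obtain ⟨B', π, hπ, y, hy⟩ := hex (x ≫ biprod.fst) (by
        have : x = (x ≫ biprod.fst) ≫ biprod.inl + (x ≫ biprod.snd) ≫ biprod.inr := by
          apply biprod.hom_ext <;> simp
        rw [this] at hx
        simpa using hx)
      refine ⟨B', π, hπ, y ≫ biprod.inl + (π ≫ x ≫ biprod.snd) ≫ biprod.inr, ?_⟩
      dsimp at hy ⊢
      apply biprod.hom_ext
      · simp [hy]
      · simp
    · apply Preadditive.mono_of_cancel_zero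
      intro B x hx
      dsimp at x hx
      have hx1 := congrArg (fun y => y ≫ biprod.fst) hx
      have hx2 := congrArg (fun y => y ≫ biprod.snd) hx
      apply biprod.hom_ext
      · rw [← cancel_mono (ι i)]
        have : (biprod.desc (ι i ≫ biprod.inl) biprod.inr : N i ⊞ N (i + 1) ⟶ E i ⊞ N (i + 1)) ≫ biprod.fst
          = biprod.fst ≫ ι i := by apply biprod.hom_ext' <;> simp
        simpa [this] using hx1
      · have : (biprod.desc (ι i ≫ biprod.inl) biprod.inr : N i ⊞ N (i + 1) ⟶ E i ⊞ N (i + 1)) ≫ biprod.snd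
          = biprod.snd := by apply biprod.hom_ext' <;> simp
        simpa [this] using hx2
    · dsimp
      have : Epi (biprod.inl ≫ biprod.desc (p i) (0 : N (i + 1) ⟶ F i)) := by simpa using he
      exact epi_of_epi biprod.inl _
  exact quasiIso_g hS (tw_id_acyclic N)

end


lemma ses_of_epi {C : Type*} [Category C] [Abelian C] {X Y : C} (p : X ⟶ Y) [Epi p] :
    (ShortComplex.mk (kernel.ι p) p (kernel.condition p)).ShortExact :=
  { exact := ShortComplex.exact_of_f_is_kernel _ (kernelIsKernel p)
    mono_f := by dsimp; infer_instance
    epi_g := by dsimp; infer_instance }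

lemma ses_pullback {C : Type*} [Category C] [Abelian C] {X Y Z : C} (p : X ⟶ Y) [Epi p]
    (f : Z ⟶ Y) :
    ∃ (w : pullback.lift (f := p) (g := f) (kernel.ι p) 0 (by simp) ≫ pullback.snd p f = 0),
      (ShortComplex.mk _ _ w).ShortExact := by
  refine ⟨pullback.lift_snd _ _ _, ?_⟩
  refine ShortComplex.ShortExact.mk' ?_ ?_ ?_
  · rw [ShortComplex.exact_iff_exact_up_to_refinements]
    intro B x hx
    dsimp at x hx
    refine ⟨B, 𝟙 B, inferInstance, kernel.lift p (x ≫ pullback.fst p f) ?_, ?_⟩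
    · rw [Category.assoc, pullback.condition, reassoc_of% hx, zero_comp]
    · dsimp
      apply pullback.hom_ext
      · rw [Category.id_comp, Category.assoc, pullback.lift_fst, kernel.lift_ι]
      · rw [Category.id_comp, Category.assoc, pullback.lift_snd, comp_zero, hx]
  · dsimp
    have : Mono (pullback.lift (f := p) (g := f) (kernel.ι p) 0 (by simp) ≫ pullback.fst p f) := by
      rw [pullback.lift_fst]; infer_instance
    exact mono_of_mono _ (pullback.fst p f)
  · dsimp; infer_instance

lemma ses_biprod {C : Type*} [Category C] [Abelian C] (X Y : C) :
    (ShortComplex.mk (biprod.inr : Y ⟶ X ⊞ Y) biprod.fst (by simp)).ShortExact := by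
  refine ShortComplex.ShortExact.mk' ?_ ?_ ?_
  · rw [ShortComplex.exact_iff_exact_up_to_refinements]
    intro B x hx
    dsimp at x hx
    refine ⟨B, 𝟙 B, inferInstance, x ≫ biprod.snd, ?_⟩
    dsimp
    apply biprod.hom_ext <;> simp [hx]
  · dsimp; infer_instance
  · dsimp; infer_instance

section
variable {A : Type} [SmallCategory A] [Abelian A] {t : ℕ}

lemma exists_epi_acyclic (Y : Ct A t) : ∃ (D : Ct A t) (π : D ⟶ Y), D.Acyclic ∧ Epi π := by
  refine ⟨tw (fun i => 𝟙 (Y.X (i - 1))), twDesc _ Y (fun i => Y.d (i - 1) i)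
    (fun i => eqToHom (by rw [add_sub_cancel_right])) (fun i => Y.d_comp_d _ _ _)
    (fun i => ?_), tw_id_acyclic _, ?_⟩
  · have : ∀ (j : ZMod t) (h : j = i), eqToHom (by rw [h]) ≫ Y.d i (i + 1) = 𝟙 _ ≫ Y.d j (i + 1) := by
      rintro j rfl; rfl
    exact this (i + 1 - 1) (by ring)
  · have := fun i => epi_of_epi_fac (biprod.inr_desc (Y.d (i - 1) i)
      (eqToHom (by rw [add_sub_cancel_right]) : Y.X (i + 1 - 1) ⟶ Y.X i))
    apply +allowSynthFailures HomologicalComplex.epi_of_epi_f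
    exact this

lemma ore_s14 ⦃X Y Y' : Ct A t⦄ (f : X ⟶ Y) (s : Y' ⟶ Y)
    (hs : HomologicalComplex.quasiIso A (pShape t) s) :
    ∃ (X' : Ct A t) (s' : X' ⟶ X) (f' : X' ⟶ Y'), HomologicalComplex.quasiIso A (pShape t) s' ∧
      (HomologicalComplex.quasiIso A (pShape t)).Q.map f' ≫
        (HomologicalComplex.quasiIso A (pShape t)).Q.map s =
      (HomologicalComplex.quasiIso A (pShape t)).Q.map s' ≫
        (HomologicalComplex.quasiIso A (pShape t)).Q.map f := by
  have hs' : QuasiIso s := hs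
  obtain ⟨D, π, hD, hπ⟩ := exists_epi_acyclic Y
  let p : Y' ⊞ D ⟶ Y := biprod.desc s π
  have hp : Epi p := epi_of_epi_fac (biprod.inr_desc s π)
  have hfst : QuasiIso (biprod.fst : Y' ⊞ D ⟶ Y') := quasiIso_g (ses_biprod Y' D) hD
  have hinl : QuasiIso (biprod.inl : Y' ⟶ Y' ⊞ D) := by
    have : QuasiIso ((biprod.inl : Y' ⟶ Y' ⊞ D) ≫ biprod.fst) := by
      rw [biprod.inl_fst]; infer_instance
    exact quasiIso_of_comp_right _ biprod.fst
  have hpq : QuasiIso p := by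
    have : QuasiIso (biprod.inl ≫ p) := by
      rw [biprod.inl_desc]; infer_instance
    exact quasiIso_of_comp_left biprod.inl _
  obtain ⟨w, hw⟩ := ses_pullback p f
  refine ⟨pullback p f, pullback.snd p f, pullback.fst p f ≫ biprod.fst,
    quasiIso_g hw ((ses_of_epi p).acyclic_X₁ hpq), ?_⟩
  have hiso : IsIso ((HomologicalComplex.quasiIso A (pShape t)).Q.map
    (biprod.inl : Y' ⟶ Y' ⊞ D)) :=
    Localization.inverts _ (HomologicalComplex.quasiIso A (pShape t)) _ hinl
  have key : (HomologicalComplex.quasiIso A (pShape t)).Q.map (biprod.fst : Y' ⊞ D ⟶ Y') ≫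
      (HomologicalComplex.quasiIso A (pShape t)).Q.map s =
      (HomologicalComplex.quasiIso A (pShape t)).Q.map p := by
    rw [← cancel_epi ((HomologicalComplex.quasiIso A (pShape t)).Q.map
      (biprod.inl : Y' ⟶ Y' ⊞ D)), ← Functor.map_comp, ← Functor.map_comp, ← Functor.map_comp]
    simp [p]
  rw [Functor.map_comp, Category.assoc, key, ← Functor.map_comp, ← Functor.map_comp,
    pullback.condition]

lemma roofCt {E : Type*} [Category E] (L : Ct A t ⥤ E)
    [L.IsLocalization (HomologicalComplex.quasiIso A (pShape t))]
    {X Y : Ct A t} (u : L.obj X ⟶ L.obj Y) :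
    ∃ (X' : Ct A t) (s : X' ⟶ X) (m : X' ⟶ Y), QuasiIso s ∧ L.map s ≫ u = L.map m :=
  roof_s14 (HomologicalComplex.quasiIso A (pShape t)) ore_s14 L u

end

section
variable {A : Type} [SmallCategory A] [Abelian A] {t : ℕ}

lemma ses_image {C : Type*} [Category C] [Abelian C] {X Z F : C} (a : X ⟶ Z) (p : Z ⟶ F)
    (w : a ≫ p = 0) (h : (ShortComplex.mk a p w).Exact) [Epi p] :
    ∃ w' : Abelian.image.ι a ≫ p = 0, (ShortComplex.mk (Abelian.image.ι a) p w').ShortExact := by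
  have w' : Abelian.image.ι a ≫ p = 0 := by
    rw [← cancel_epi (Abelian.factorThruImage a), ← Category.assoc, Abelian.image.fac, w, comp_zero]
  refine ⟨w', ShortComplex.ShortExact.mk' ?_ ?_ ?_⟩
  · rw [ShortComplex.exact_iff_exact_up_to_refinements] at h ⊢
    intro B x hx
    obtain ⟨B', π, hπ, y, hy⟩ := h x hx
    refine ⟨B', π, hπ, y ≫ Abelian.factorThruImage a, ?_⟩
    dsimp at hy ⊢
    rw [hy, Category.assoc, Abelian.image.fac]
  · dsimp; infer_instance
  · dsimp; infer_instance

lemma cycles_exact {f : ZMod t → A} {X : Ct A t} (s : X ⟶ mkZ f) [QuasiIso s] (j i : ZMod t)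
    (hij : (pShape t).Rel j i) :
    ∃ (w : X.toCycles j i ≫ X.iCycles i ≫ s.f i = 0),
      (ShortComplex.mk (X.toCycles j i) (X.iCycles i ≫ s.f i) w).Exact ∧
      Epi (X.iCycles i ≫ s.f i) := by
  have h1 : IsIso ((mkZ f).iCycles i) := (mkZ f).isIso_iCycles i (i + 1)
    ((pShape t).next_eq' rfl) rfl
  have h2 : IsIso ((mkZ f).homologyπ i) := (mkZ f).isIso_homologyπ j i
    ((pShape t).prev_eq' hij) rfl
  let θ := asIso (HomologicalComplex.homologyMap s i) ≪≫ (asIso ((mkZ f).homologyπ i)).symm ≪≫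
    asIso ((mkZ f).iCycles i)
  have hθ : X.iCycles i ≫ s.f i = X.homologyπ i ≫ θ.hom := by
    simp [θ]
  have w : X.toCycles j i ≫ X.iCycles i ≫ s.f i = 0 := by
    rw [hθ, HomologicalComplex.toCycles_comp_homologyπ_assoc, zero_comp]
  refine ⟨w, ?_, ?_⟩
  · have he : (ShortComplex.mk (X.toCycles j i) (X.homologyπ i) (by simp)).Exact :=
      ShortComplex.exact_of_g_is_cokernel _ (X.homologyIsCokernel j i ((pShape t).prev_eq' hij))
    refine ShortComplex.exact_of_iso ?_ he
    exact ShortComplex.isoMk (Iso.refl _) (Iso.refl _) θ (by simp) (by simp [hθ])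
  · rw [hθ]; infer_instance

lemma lift_data [HasExt.{0} A]
    (hered : ∀ X Y : A, Subsingleton (Abelian.Ext X Y 2))
    {f : ZMod t → A} {X : Ct A t} (s : X ⟶ mkZ f) [QuasiIso s] (j i k : ZMod t)
    (hij : (pShape t).Rel j i) :
    ∃ (E : A) (ι : kernel (s.f j) ⟶ E) (q : E ⟶ f i) (w : ι ≫ q = 0)
      (_ : (ShortComplex.mk ι q w).ShortExact) (c : E ⟶ X.X i),
      ι ≫ c = kernel.ι (s.f j) ≫ X.d j i ∧ c ≫ s.f i = q ∧ c ≫ X.d i k = 0 := by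
  obtain ⟨w, hex, hepi⟩ := cycles_exact s j i hij
  obtain ⟨-, -, hepi'⟩ := cycles_exact s (j - 1) j (by simp [pShape])
  obtain ⟨w', hS⟩ := ses_image _ _ w hex
  have hπ : Epi (kernel.ι (s.f j) ≫ Abelian.factorThruImage (X.toCycles j i)) := by
    rw [epi_iff_surjective_up_to_refinements]
    intro T y
    obtain ⟨T₁, π₁, hπ₁, x, hx⟩ := surjective_up_to_refinements_of_epi
      (Abelian.factorThruImage (X.toCycles j i)) y
    obtain ⟨T₂, π₂, hπ₂, z, hz⟩ := surjective_up_to_refinements_of_epi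
      (X.iCycles j ≫ s.f j) (x ≫ s.f j)
    refine ⟨T₂, π₂ ≫ π₁, epi_comp _ _,
      kernel.lift (s.f j) (π₂ ≫ x - z ≫ X.iCycles j) (by simp [hz]), ?_⟩
    rw [← cancel_mono (Abelian.image.ι (X.toCycles j i)), ← cancel_mono (X.iCycles i)]
    simp [hx]
  obtain ⟨E, ι, q, w, hE, c, h1, h2⟩ := ses_lift hered hS
    (kernel.ι (s.f j) ≫ Abelian.factorThruImage (X.toCycles j i))
  refine ⟨E, ι, q, w, hE, c ≫ X.iCycles i, ?_, ?_, ?_⟩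
  · rw [reassoc_of% h1]; simp
  · rw [Category.assoc, h2]
  · simp

def sT {N E F : ZMod t → A} (ι : ∀ i, N i ⟶ E i) (p : ∀ i, E i ⟶ F i)
    (w : ∀ i, ι i ≫ p i = 0) : tw ι ⟶ mkZ F :=
  twDesc ι (mkZ F) p (fun _ => 0) (fun _ => comp_zero) (fun i => by rw [w]; exact comp_zero)

def mT {N E F G : ZMod t → A} (ι : ∀ i, N i ⟶ E i) (p : ∀ i, E i ⟶ F i)
    (w : ∀ i, ι i ≫ p i = 0) (φ : ∀ i, F i ⟶ G i) (b : ∀ i, N i ⟶ G (i - 1)) :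
    tw ι ⟶ mkZ G :=
  twDesc ι (mkZ G) (fun i => p i ≫ φ i)
    (fun i => b (i + 1) ≫ eqToHom (by rw [add_sub_cancel_right]))
    (fun _ => comp_zero) (fun i => by
      rw [← Category.assoc, w, zero_comp]; exact comp_zero)

variable {D : Type*} [Category D] (L : Ct A t ⥤ D)
    [L.IsLocalization (HomologicalComplex.quasiIso A (pShape t))]

lemma isIso_sT {N E F : ZMod t → A} (ι : ∀ i, N i ⟶ E i) (p : ∀ i, E i ⟶ F i)
    (w : ∀ i, ι i ≫ p i = 0) (h : ∀ i, (ShortComplex.mk (ι i) (p i) (w i)).ShortExact) :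
    IsIso (L.map (sT ι p w)) :=
  Localization.inverts L (HomologicalComplex.quasiIso A (pShape t)) _ (tw_ses h _ _)

variable [HasExt.{0} A]

def R {f g : ZMod t → A} (u : L.obj (mkZ f) ⟶ L.obj (mkZ g)) (φ : ∀ i, f i ⟶ g i)
    (ε : ∀ i, Abelian.Ext (f i) (g (i - 1)) 1) : Prop :=
  ∃ (N E : ZMod t → A) (ι : ∀ i, N i ⟶ E i) (p : ∀ i, E i ⟶ f i) (w : ∀ i, ι i ≫ p i = 0)
    (h : ∀ i, (ShortComplex.mk (ι i) (p i) (w i)).ShortExact) (b : ∀ i, N i ⟶ g (i - 1)),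
    L.map (sT ι p w) ≫ u = L.map (mT ι p w φ b) ∧
    ∀ i, (h i).extClass.comp (Abelian.Ext.mk₀ (b i)) (add_zero 1) = ε i

lemma R_exists {f g : ZMod t → A} (φ : ∀ i, f i ⟶ g i)
    (ε : ∀ i, Abelian.Ext (f i) (g (i - 1)) 1) : ∃ u, R L u φ ε := by
  choose E ι p w h hε using fun i => exists_ses_s14 (ε i)
  have := isIso_sT L ι p w h
  refine ⟨inv (L.map (sT ι p w)) ≫ L.map (mT ι p w φ (fun _ => 𝟙 _)), _, E, ι, p, w, h,
    fun _ => 𝟙 _, by simp, fun i => ?_⟩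
  rw [Abelian.Ext.comp_mk₀_id, hε]

lemma R_unique {f g : ZMod t → A} (φ : ∀ i, f i ⟶ g i)
    (ε : ∀ i, Abelian.Ext (f i) (g (i - 1)) 1) : ∃ v, ∀ u, R L u φ ε → u = v := by
  choose E ι p w h hε using fun i => exists_ses_s14 (ε i)
  have := isIso_sT L ι p w h
  refine ⟨inv (L.map (sT ι p w)) ≫ L.map (mT ι p w φ (fun _ => 𝟙 _)), ?_⟩
  rintro u ⟨N, E', ι', p', w', h', b, hu, hε'⟩
  have := isIso_sT L ι' p' w' h'
  choose c hc1 hc2 using fun i => ses_map (h' i) (h i) (b i) (by rw [hε', hε])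
  let r : tw ι' ⟶ tw ι := twDesc ι' _ (fun i => c i ≫ biprod.inl)
    (fun i => b (i + 1) ≫ biprod.inr) (fun i => by dsimp only; rw [twd_eq]; simp)
      (fun i => by dsimp only; rw [twd_eq]; simp [reassoc_of% (hc1 (i + 1))])
  have hr1 : r ≫ sT ι p w = sT ι' p' w' := by
    refine HomologicalComplex.hom_ext _ _ fun i => ?_
    change biprod.desc (c i ≫ biprod.inl) (b (i + 1) ≫ biprod.inr) ≫ biprod.desc (p i) 0 =
      biprod.desc (p' i) 0
    apply biprod.hom_ext' <;> simp [hc2]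
  have hr2 : r ≫ mT ι p w φ (fun _ => 𝟙 _) = mT ι' p' w' φ b := by
    refine HomologicalComplex.hom_ext _ _ fun i => ?_
    change biprod.desc (c i ≫ biprod.inl) (b (i + 1) ≫ biprod.inr) ≫
      biprod.desc (p i ≫ φ i) (𝟙 _ ≫ eqToHom _) =
      biprod.desc (p' i ≫ φ i) (b (i + 1) ≫ eqToHom _)
    apply biprod.hom_ext' <;> simp [reassoc_of% hc2]
  rw [← cancel_epi (L.map (sT ι' p' w')), hu, ← hr1, ← hr2]
  simp

lemma R_surj (hered : ∀ X Y : A, Subsingleton (Abelian.Ext X Y 2))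
    {f g : ZMod t → A} (u : L.obj (mkZ f) ⟶ L.obj (mkZ g)) :
    ∃ φ ε, R L u φ ε := by
  obtain ⟨X, s, m, hs, hu⟩ := roofCt L u
  choose E ι q w h c hc1 hc2 hc3 using fun i => lift_data hered s (i - 1) i (i + 1)
    (by simp [pShape])
  have hφ : ∀ i, ∃ φ : f i ⟶ g i, q i ≫ φ = c i ≫ m.f i := fun i => by
    have := (h i).epi_g
    dsimp at this
    have e : ι i ≫ c i ≫ m.f i = 0 := by
      rw [reassoc_of% (hc1 i), ← m.comm]
      change _ ≫ _ ≫ 0 = 0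
      simp
    exact ⟨(h i).exact.desc (c i ≫ m.f i) e, (h i).exact.g_desc _ _⟩
  choose φ hφ using hφ
  refine ⟨φ, _, _, E, ι, q, w, h, fun i => kernel.ι (s.f (i - 1)) ≫ m.f (i - 1), ?_,
    fun i => rfl⟩
  have cast1 : ∀ (i j : ZMod t) (e : i = j), kernel.ι (s.f i) ≫ eqToHom (by rw [e]) ≫ s.f j = 0 := by
    rintro i _ rfl; simp
  have cast2 : ∀ (i j : ZMod t) (e : i = j), eqToHom (by rw [e]) ≫ m.f j =
      m.f i ≫ eqToHom (by rw [e]) := by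
    rintro i _ rfl; simp
  have cast3 : ∀ (i j k : ZMod t) (e : i = j), eqToHom (by rw [e]) ≫ X.d j k = X.d i k := by
    rintro i _ _ rfl; simp
  let r : tw ι ⟶ X := twDesc ι X c
    (fun i => kernel.ι (s.f (i + 1 - 1)) ≫ eqToHom (by rw [add_sub_cancel_right])) hc3
    (fun i => by rw [hc1, Category.assoc, cast3 _ _ _ (by ring)])
  have hr1 : r ≫ s = sT ι q w := by
    refine HomologicalComplex.hom_ext _ _ fun i => ?_
    change biprod.desc (c i) (kernel.ι (s.f (i + 1 - 1)) ≫ eqToHom _) ≫ s.f i =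
      biprod.desc (q i) 0
    have := cast1 (i + 1 - 1) i (by ring)
    apply biprod.hom_ext'
    · simp [hc2]
    · simpa using this
  have hr2 : r ≫ m = mT ι q w φ (fun i => kernel.ι (s.f (i - 1)) ≫ m.f (i - 1)) := by
    refine HomologicalComplex.hom_ext _ _ fun i => ?_
    change biprod.desc (c i) (kernel.ι (s.f (i + 1 - 1)) ≫ eqToHom _) ≫ m.f i =
      biprod.desc (q i ≫ φ i) ((kernel.ι (s.f (i + 1 - 1)) ≫ m.f (i + 1 - 1)) ≫ eqToHom _)
    have := cast2 (i + 1 - 1) i (by ring)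
    apply biprod.hom_ext'
    · simp [hφ]
    · rw [biprod.inr_desc_assoc, biprod.inr_desc, Category.assoc, this, Category.assoc]
  rw [← hr1, ← hr2, L.map_comp, L.map_comp, Category.assoc, hu]

end


section
variable {A : Type} [SmallCategory A] [Abelian A] {t : ℕ}

@[reducible] def unrollObj (e : ℤ → ZMod t) (he : ∀ n, e (n + 1) = e n + 1) (X : Ct A t) :
    CochainComplex A ℤ where
  X n := X.X (e n)
  d n m := if n + 1 = m then X.d (e n) (e m) else 0
  shape n m h := if_neg h
  d_comp_d' := by
    rintro i _ _ rfl rfl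
    simp

def unroll (e : ℤ → ZMod t) (he : ∀ n, e (n + 1) = e n + 1) :
    Ct A t ⥤ CochainComplex A ℤ where
  obj X := unrollObj e he X
  map s :=
    { f n := s.f (e n)
      comm' := by
        rintro i _ rfl
        simp }
  map_id X := rfl
  map_comp s s' := rfl

lemma unroll_quasiIso (e : ℤ → ZMod t) (he : ∀ n, e (n + 1) = e n + 1) {X Y : Ct A t}
    (s : X ⟶ Y) [QuasiIso s] : QuasiIso ((unroll e he).map s) := by
  refine ⟨fun n => ?_⟩
  have h0 : e n = e (n - 1) + 1 := by rw [← he]; congr 1; ring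
  rw [quasiIsoAt_iff' _ (n - 1) n (n + 1) (by simp) (by simp)]
  have h := (inferInstance : QuasiIsoAt s (e n))
  rw [quasiIsoAt_iff' _ (e (n - 1)) (e n) (e (n + 1))
    ((pShape t).prev_eq' (by rw [h0]; rfl)) ((pShape t).next_eq' (by rw [he]; rfl))] at h
  let I : ∀ Z : Ct A t, ((unroll e he).obj Z).sc' (n - 1) n (n + 1) ≅
      Z.sc' (e (n - 1)) (e n) (e (n + 1)) := fun Z =>
    ShortComplex.isoMk (Iso.refl _) (Iso.refl _) (Iso.refl _)
      (by
        change 𝟙 _ ≫ Z.d (e (n-1)) (e n) = (if n - 1 + 1 = n then Z.d (e (n-1)) (e n) else 0) ≫ 𝟙 _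
        simp)
      (by
        change 𝟙 _ ≫ Z.d (e (n)) (e (n+1)) = (if n + 1 = n + 1 then Z.d (e n) (e (n+1)) else 0) ≫ 𝟙 _
        simp)
  refine (ShortComplex.quasiIso_iff_of_arrow_mk_iso _ _
    (Arrow.isoMk (I X) (I Y) ?_)).2 h
  ext
  · exact (Category.id_comp _).trans (Category.comp_id _).symm
  · exact (Category.id_comp _).trans (Category.comp_id _).symm
  · exact (Category.id_comp _).trans (Category.comp_id _).symm

variable {D : Type*} [Category D] (L : Ct A t ⥤ D)
    [L.IsLocalization (HomologicalComplex.quasiIso A (pShape t))]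

lemma exists_v [HasDerivedCategory A] (e : ℤ → ZMod t) (he : ∀ n, e (n + 1) = e n + 1)
    {X Y : Ct A t} (u : L.obj X ⟶ L.obj Y) :
    ∃ v : DerivedCategory.Q.obj ((unroll e he).obj X) ⟶
      DerivedCategory.Q.obj ((unroll e he).obj Y), ∀ (T : Ct A t) (s : T ⟶ X) (m : T ⟶ Y),
      L.map s ≫ u = L.map m →
      DerivedCategory.Q.map ((unroll e he).map s) ≫ v =
        DerivedCategory.Q.map ((unroll e he).map m) := by
  let F : Ct A t ⥤ DerivedCategory A := unroll e he ⋙ DerivedCategory.Q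
  have hF : (HomologicalComplex.quasiIso A (pShape t)).IsInvertedBy F := by
    intro X Y s hs
    rw [HomologicalComplex.mem_quasiIso_iff] at hs
    have := unroll_quasiIso e he s
    change IsIso (DerivedCategory.Q.map ((unroll e he).map s))
    infer_instance
  let α : L ⋙ Localization.lift F hF L ≅ F := Localization.fac F hF L
  refine ⟨α.inv.app X ≫ (Localization.lift F hF L).map u ≫ α.hom.app Y, fun T s m h => ?_⟩
  change F.map s ≫ _ = F.map m
  have h1 : F.map s ≫ α.inv.app X = α.inv.app T ≫ (Localization.lift F hF L).map (L.map s) :=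
    α.inv.naturality s
  have h2 : (Localization.lift F hF L).map (L.map m) ≫ α.hom.app Y = α.hom.app T ≫ F.map m :=
    α.hom.naturality m
  rw [reassoc_of% h1, ← Functor.map_comp_assoc, h, h2]
  simp

variable [HasExt.{0} A]

lemma R_canon {f g : ZMod t → A} (φ : ∀ i, f i ⟶ g i)
    (ε : ∀ i, Abelian.Ext (f i) (g (i - 1)) 1) (u) (hu : R L u φ ε) :
    ∃ (E : ZMod t → A) (ι : ∀ i, g (i - 1) ⟶ E i) (p : ∀ i, E i ⟶ f i)
      (w : ∀ i, ι i ≫ p i = 0) (h : ∀ i, (ShortComplex.mk (ι i) (p i) (w i)).ShortExact),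
    L.map (sT ι p w) ≫ u = L.map (mT ι p w φ (fun _ => 𝟙 _)) ∧
    ∀ i, (h i).extClass = ε i := by
  choose E ι p w h hε using fun i => exists_ses_s14 (ε i)
  refine ⟨E, ι, p, w, h, ?_, hε⟩
  have := isIso_sT L ι p w h
  obtain ⟨v, hv⟩ := R_unique L φ ε
  rw [hv u hu, ← hv (inv (L.map (sT ι p w)) ≫ L.map (mT ι p w φ (fun _ => 𝟙 _)))
    ⟨_, E, ι, p, w, h, fun _ => 𝟙 _, by simp, fun i => by rw [Abelian.Ext.comp_mk₀_id, hε]⟩]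
  simp

end


section
open CochainComplex HomComplex

variable {A : Type} [SmallCategory A] [Abelian A]

def coneMap {N E : A} (ι : N ⟶ E) {T : CochainComplex A ℤ} (a : E ⟶ T.X 0) (b : N ⟶ T.X (-1))
    (ha : a ≫ T.d 0 1 = 0) (hb : b ≫ T.d (-1) 0 = ι ≫ a) :
    mappingCone ((CochainComplex.singleFunctor A 0).map ι) ⟶ T :=
  mappingCone.desc _ (Cochain.fromSingleMk b (by simp))
    (Cocycle.homOf (Cocycle.fromSingleMk a (zero_add 0) 1 (by simp) ha)) (by
      rw [Cochain.δ_fromSingleMk _ _ 0 0 (by simp), hb, Cochain.fromSingleMk_precomp,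
        Cochain.ofHom_comp, Cocycle.cochain_ofHom_homOf_eq_coe]
      rfl)

lemma ofHom_inj {K K' : CochainComplex A ℤ} {x y : K ⟶ K'} (h : Cochain.ofHom x = Cochain.ofHom y) :
    x = y := by
  ext n
  simpa using Cochain.congr_v h n n (add_zero n)

lemma cochain_single_zero {X Y : A} (z : Cochain ((CochainComplex.singleFunctor A 0).obj X)
    ((CochainComplex.singleFunctor A 0).obj Y) (-1)) : z = 0 := by
  ext p q hpq
  by_cases hp : p = 0
  · exact (HomologicalComplex.isZero_single_obj_X _ _ _ _ (by omega)).eq_of_tgt _ _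
  · exact (HomologicalComplex.isZero_single_obj_X _ _ _ _ hp).eq_of_src _ _

lemma cochain_single_zero' {X Y : A} (z : Cochain ((CochainComplex.singleFunctor A 0).obj X)
    ((CochainComplex.singleFunctor A 0).obj Y) 1) : z = 0 := by
  ext p q hpq
  by_cases hp : p = 0
  · exact (HomologicalComplex.isZero_single_obj_X _ _ _ _ (by omega)).eq_of_tgt _ _
  · exact (HomologicalComplex.isZero_single_obj_X _ _ _ _ hp).eq_of_src _ _


def jMap {F : A} {F' : CochainComplex A ℤ} (j : F ⟶ F'.X 0) (hj : j ≫ F'.d 0 1 = 0) :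
    (CochainComplex.singleFunctor A 0).obj F ⟶ F' :=
  Cocycle.homOf (Cocycle.fromSingleMk j (zero_add 0) 1 (by simp) hj)

lemma ofHom_jMap {F : A} {F' : CochainComplex A ℤ} (j : F ⟶ F'.X 0) (hj : j ≫ F'.d 0 1 = 0) :
    Cochain.ofHom (jMap j hj) = Cochain.fromSingleMk j (zero_add 0) :=
  Cocycle.cochain_ofHom_homOf_eq_coe _

def rMap {M : A} {G' : CochainComplex A ℤ} (r : G'.X 0 ⟶ M) (hr : G'.d (-1) 0 ≫ r = 0) :
    G' ⟶ (CochainComplex.singleFunctor A 0).obj M :=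
  Cocycle.homOf (Cocycle.toSingleMk r (zero_add 0) (-1) (by simp) hr)

lemma ofHom_rMap {M : A} {G' : CochainComplex A ℤ} (r : G'.X 0 ⟶ M) (hr : G'.d (-1) 0 ≫ r = 0) :
    Cochain.ofHom (rMap r hr) = Cochain.toSingleMk r (zero_add 0) :=
  Cocycle.cochain_ofHom_homOf_eq_coe _

def qMap {M : A} {G' : CochainComplex A ℤ} (q : G'.X (-1) ⟶ M) (hq : G'.d (-2) (-1) ≫ q = 0) :
    G' ⟶ ((CochainComplex.singleFunctor A 0).obj M)⟦(1 : ℤ)⟧ :=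
  Cocycle.equivHomShift.symm
      (Cocycle.toSingleMk q (by simp) (-2) (by simp) hq : Cocycle _ _ 1)

lemma from_to_single {X Y : A} {K : CochainComplex A ℤ} {k n n' : ℤ} (a : X ⟶ K.X k) (r : K.X k ⟶ Y)
    (h : 0 + n = k) (h' : k + n' = 0) (hn : n + n' = 0) :
    (Cochain.fromSingleMk a h).comp (Cochain.toSingleMk r h') hn =
      Cochain.ofHom ((CochainComplex.singleFunctor A 0).map (a ≫ r)) := by
  apply (Cochain.fromSingleEquiv (zero_add 0)).injective
  refine congrArg (fun z => (HomologicalComplex.singleObjXSelf (.up ℤ) 0 X).inv ≫ z) ?_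
  refine (Cochain.comp_v _ _ hn 0 k 0 h h').trans ?_
  rw [Cochain.fromSingleMk_v, Cochain.toSingleMk_v, Cochain.ofHom_v]
  refine Eq.trans ?_ (HomologicalComplex.single_map_f_self (c := .up ℤ) 0 (a ≫ r)).symm
  simp only [Category.assoc]
  exact Category.assoc _ _ _

variable {N E F : A} (ι : N ⟶ E) (p : E ⟶ F) (w : ι ≫ p = 0)

@[reducible] def sgl : ShortComplex (CochainComplex A ℤ) :=
  ShortComplex.mk ((CochainComplex.singleFunctor A 0).map ι)
    ((CochainComplex.singleFunctor A 0).map p) (by rw [← Functor.map_comp, w, Functor.map_zero])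

/-- comparison of `coneMap` with `descShortComplex`. -/
lemma coneMap_comp {T F' : CochainComplex A ℤ} (a : E ⟶ T.X 0) (b : N ⟶ T.X (-1))
    (ha : a ≫ T.d 0 1 = 0) (hb : b ≫ T.d (-1) 0 = ι ≫ a)
    (j : F ⟶ F'.X 0) (hj : j ≫ F'.d 0 1 = 0) (s : T ⟶ F')
    (h1 : a ≫ s.f 0 = p ≫ j) (h2 : b ≫ s.f (-1) = 0) :
    coneMap ι a b ha hb ≫ s = mappingCone.descShortComplex (sgl ι p w) ≫ jMap j hj := by
  apply ofHom_inj
  rw [mappingCone.ext_cochain_from_iff _ (-1) 0 (by simp)]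
  constructor
  · rw [Cochain.ofHom_comp, Cochain.ofHom_comp, ← Cochain.comp_assoc_of_second_is_zero_cochain,
      ← Cochain.comp_assoc_of_second_is_zero_cochain]
    dsimp only [coneMap, mappingCone.descShortComplex]
    rw [mappingCone.inl_desc, mappingCone.inl_desc, Cochain.zero_comp,
      ← Cochain.fromSingleMk_postcomp, h2, Cochain.fromSingleMk_zero]
  · rw [← Cochain.ofHom_comp, ← Cochain.ofHom_comp]
    dsimp only [coneMap, mappingCone.descShortComplex]
    rw [mappingCone.inr_desc_assoc, mappingCone.inr_desc_assoc]
    change Cochain.ofHom (jMap a ha ≫ s) = _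
    rw [Cochain.ofHom_comp, Cochain.ofHom_comp, ofHom_jMap, ofHom_jMap]
    rw [← Cochain.fromSingleMk_postcomp, ← Cochain.fromSingleMk_precomp]
    rw [h1]

lemma coneMap_hom {T G' : CochainComplex A ℤ} {M : A} (a : E ⟶ T.X 0) (b : N ⟶ T.X (-1))
    (ha : a ≫ T.d 0 1 = 0) (hb : b ≫ T.d (-1) 0 = ι ≫ a)
    (r : G'.X 0 ⟶ M) (hr : G'.d (-1) 0 ≫ r = 0) (m : T ⟶ G') (φ : F ⟶ M)
    (h1 : a ≫ m.f 0 ≫ r = p ≫ φ) :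
    coneMap ι a b ha hb ≫ m ≫ rMap r hr
      = mappingCone.descShortComplex (sgl ι p w) ≫ (CochainComplex.singleFunctor A 0).map φ := by
  apply ofHom_inj
  rw [mappingCone.ext_cochain_from_iff _ (-1) 0 (by simp)]
  constructor
  · rw [cochain_single_zero (Cochain.comp _ _ _)]
    exact (cochain_single_zero _).symm
  · rw [← Cochain.ofHom_comp, ← Cochain.ofHom_comp]
    dsimp only [coneMap, mappingCone.descShortComplex]
    rw [mappingCone.inr_desc_assoc, mappingCone.inr_desc_assoc, ← Functor.map_comp, ← h1]
    change Cochain.ofHom (jMap a ha ≫ m ≫ rMap r hr) = _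
    rw [Cochain.ofHom_comp, Cochain.ofHom_comp, ofHom_jMap, ofHom_rMap]
    rw [← Cochain.toSingleMk_precomp, from_to_single]

lemma coneMap_ext {T G' : CochainComplex A ℤ} (a : E ⟶ T.X 0) (b : N ⟶ T.X (-1))
    (ha : a ≫ T.d 0 1 = 0) (hb : b ≫ T.d (-1) 0 = ι ≫ a)
    (q : G'.X (-1) ⟶ N) (hq : G'.d (-2) (-1) ≫ q = 0) (m : T ⟶ G')
    (h1 : b ≫ m.f (-1) ≫ q = 𝟙 _) :
    coneMap ι a b ha hb ≫ m ≫ qMap q hq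
      = - (mappingCone.triangle ((CochainComplex.singleFunctor A 0).map ι)).mor₃ := by
  have : - (mappingCone.triangle ((CochainComplex.singleFunctor A 0).map ι)).mor₃ =
      Cocycle.equivHomShift.symm (mappingCone.fst ((CochainComplex.singleFunctor A 0).map ι)) := by
    have : (mappingCone.triangle ((CochainComplex.singleFunctor A 0).map ι)).mor₃ =
      Cocycle.equivHomShift.symm (-mappingCone.fst ((CochainComplex.singleFunctor A 0).map ι)) := rfl
    rw [this]
    exact (congrArg Neg.neg (map_neg _ _)).trans (neg_neg _)
  rw [this, qMap, ← Category.assoc, ← Cocycle.equivHomShift_symm_precomp]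
  congr 1
  ext1
  rw [mappingCone.ext_cochain_from_iff _ 0 1 (by simp)]
  constructor
  · rw [mappingCone.inl_fst]
    change Cochain.comp _ ((Cochain.ofHom (coneMap ι a b ha hb ≫ m)).comp
      (Cochain.toSingleMk q (by simp)) (zero_add 1)) _ = _
    rw [Cochain.ofHom_comp, Cochain.comp_assoc_of_first_is_zero_cochain,
      ← Cochain.comp_assoc_of_second_is_zero_cochain]
    dsimp only [coneMap]
    rw [mappingCone.inl_desc, ← Cochain.toSingleMk_precomp, from_to_single, h1,
      CategoryTheory.Functor.map_id]
  · rw [cochain_single_zero' (Cochain.comp _ _ _)]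
    exact (cochain_single_zero' _).symm

end


section
open CochainComplex HomComplex

variable {A : Type} [SmallCategory A] [Abelian A] [HasDerivedCategory A]
 {N E F : A} (ι : N ⟶ E) (p : E ⟶ F) (w : ι ≫ p = 0)

lemma sgl_exact (h : (ShortComplex.mk ι p w).ShortExact) : (sgl ι p w).ShortExact :=
  h.map_of_exact (HomologicalComplex.single A (ComplexShape.up ℤ) 0)

lemma detect_hom (h : (ShortComplex.mk ι p w).ShortExact)
    {T F' G' : CochainComplex A ℤ} {M : A} (a : E ⟶ T.X 0) (b : N ⟶ T.X (-1))
    (ha : a ≫ T.d 0 1 = 0) (hb : b ≫ T.d (-1) 0 = ι ≫ a)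
    (j : F ⟶ F'.X 0) (hj : j ≫ F'.d 0 1 = 0) (s : T ⟶ F')
    (h1 : a ≫ s.f 0 = p ≫ j) (h2 : b ≫ s.f (-1) = 0)
    (r : G'.X 0 ⟶ M) (hr : G'.d (-1) 0 ≫ r = 0) (m : T ⟶ G') (φ : F ⟶ M)
    (h3 : a ≫ m.f 0 ≫ r = p ≫ φ)
    (v : DerivedCategory.Q.obj F' ⟶ DerivedCategory.Q.obj G')
    (hv : DerivedCategory.Q.map s ≫ v = DerivedCategory.Q.map m) :
    DerivedCategory.Q.map (jMap j hj) ≫ v ≫ DerivedCategory.Q.map (rMap r hr) =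
      DerivedCategory.Q.map ((CochainComplex.singleFunctor A 0).map φ) := by
  have := mappingCone.quasiIso_descShortComplex (sgl_exact ι p w h)
  rw [← cancel_epi (DerivedCategory.Q.map (mappingCone.descShortComplex (sgl ι p w))),
    ← Functor.map_comp_assoc, ← coneMap_comp ι p w a b ha hb j hj s h1 h2, Functor.map_comp_assoc,
    reassoc_of% hv, ← Functor.map_comp, ← Functor.map_comp, ← Functor.map_comp,
    coneMap_hom ι p w a b ha hb r hr m φ h3]

lemma detect_ext (h : (ShortComplex.mk ι p w).ShortExact)
    {T F' G' : CochainComplex A ℤ} (a : E ⟶ T.X 0) (b : N ⟶ T.X (-1))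
    (ha : a ≫ T.d 0 1 = 0) (hb : b ≫ T.d (-1) 0 = ι ≫ a)
    (j : F ⟶ F'.X 0) (hj : j ≫ F'.d 0 1 = 0) (s : T ⟶ F')
    (h1 : a ≫ s.f 0 = p ≫ j) (h2 : b ≫ s.f (-1) = 0)
    (q : G'.X (-1) ⟶ N) (hq : G'.d (-2) (-1) ≫ q = 0) (m : T ⟶ G')
    (h3 : b ≫ m.f (-1) ≫ q = 𝟙 _)
    (v : DerivedCategory.Q.obj F' ⟶ DerivedCategory.Q.obj G')
    (hv : DerivedCategory.Q.map s ≫ v = DerivedCategory.Q.map m) :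
    DerivedCategory.Q.map (jMap j hj) ≫ v ≫ DerivedCategory.Q.map (qMap q hq) ≫
      (Functor.commShiftIso DerivedCategory.Q 1).hom.app
        ((CochainComplex.singleFunctor A 0).obj N) =
      - DerivedCategory.triangleOfSESδ (sgl_exact ι p w h) := by
  have := mappingCone.quasiIso_descShortComplex (sgl_exact ι p w h)
  rw [← cancel_epi (DerivedCategory.Q.map (mappingCone.descShortComplex (sgl ι p w))),
    ← Functor.map_comp_assoc, ← coneMap_comp ι p w a b ha hb j hj s h1 h2, Functor.map_comp_assoc,
    reassoc_of% hv, ← Functor.map_comp_assoc, ← Functor.map_comp_assoc, Category.assoc,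
    coneMap_ext ι a b ha hb q hq m h3, Preadditive.comp_neg, DerivedCategory.descShortComplex_triangleOfSESδ]
  exact (congrArg (fun z => z ≫ (Functor.commShiftIso DerivedCategory.Q 1).hom.app
        ((CochainComplex.singleFunctor A 0).obj N)) (Functor.map_neg DerivedCategory.Q)).trans
        (Preadditive.neg_comp _ _)

lemma single_inj {X Y : A} {x y : X ⟶ Y} (h : DerivedCategory.Q.map ((CochainComplex.singleFunctor A 0).map x) =
   DerivedCategory.Q.map ((CochainComplex.singleFunctor A 0).map y)) : x = y := by
  apply (DerivedCategory.singleFunctor A 0).map_injective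
  exact h

lemma extClass_inj [HasExt.{0} A] {E' : A} (ι' : N ⟶ E') (p' : E' ⟶ F) (w' : ι' ≫ p' = 0)
    (h : (ShortComplex.mk ι p w).ShortExact) (h' : (ShortComplex.mk ι' p' w').ShortExact)
    (hh : DerivedCategory.triangleOfSESδ (sgl_exact ι p w h) =
      DerivedCategory.triangleOfSESδ (sgl_exact ι' p' w' h')) :
    h.extClass = h'.extClass := by
  ext
  rw [ShortComplex.ShortExact.extClass_hom, ShortComplex.ShortExact.extClass_hom]
  exact congrArg (fun z => (((SingleFunctors.evaluation _ _ 0).mapIso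
    (DerivedCategory.singleFunctorsPostcompQIso A)).hom.app F) ≫ z ≫
    (((SingleFunctors.evaluation _ _ 0).mapIso
      (DerivedCategory.singleFunctorsPostcompQIso A)).inv.app N)⟦(1 : ℤ)⟧') hh

end


section
variable {A : Type} [SmallCategory A] [Abelian A] {t : ℕ}

lemma twd_inl {N E : ZMod t → A} (ι : ∀ i, N i ⟶ E i) (i j : ZMod t) :
    biprod.inl ≫ twd ι i j = 0 := by
  by_cases h : i + 1 = j
  · subst h
    rw [twd_eq]; simp
  · rw [twd, dif_neg h, comp_zero]

lemma twd_inr {N E : ZMod t → A} (ι : ∀ i, N i ⟶ E i) (i j : ZMod t) (h : i + 1 = j) :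
    (eqToHom (by rw [h]) ≫ biprod.inr : N j ⟶ E i ⊞ N (i + 1)) ≫ twd ι i j =
      ι j ≫ biprod.inl := by
  subst h
  rw [twd_eq]; simp

lemma mT_cast {g : ZMod t → A} (i j : ZMod t) (h : i + 1 = j) :
    eqToHom (by rw [h] : g (j - 1) = g (i + 1 - 1)) ≫
      (𝟙 (g (i + 1 - 1)) ≫ eqToHom (by rw [add_sub_cancel_right]) : g (i + 1 - 1) ⟶ g i) ≫
      eqToHom (by rw [← h, add_sub_cancel_right] : g i = g (j - 1)) = 𝟙 _ := by
  simp

lemma unroll_d (e : ℤ → ZMod t) (he : ∀ n, e (n + 1) = e n + 1) (X : Ct A t) (n m : ℤ)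
    (h : n + 1 = m) : ((unroll e he).obj X).d n m = X.d (e n) (e m) := if_pos h

lemma unroll_d_zero (e : ℤ → ZMod t) (he : ∀ n, e (n + 1) = e n + 1) (f : ZMod t → A) (n m : ℤ) :
    ((unroll e he).obj (mkZ f)).d n m = 0 := ite_self _

variable {D : Type*} [Category D] (L : Ct A t ⥤ D)
    [L.IsLocalization (HomologicalComplex.quasiIso A (pShape t))] [HasExt.{0} A]

lemma R_inj_aux {f g : ZMod t → A} (φ φ' : ∀ i, f i ⟶ g i)
    (ε ε' : ∀ i, Abelian.Ext (f i) (g (i - 1)) 1) (u) (hu : R L u φ ε) (hu' : R L u φ' ε')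
    (e : ℤ → ZMod t) (he : ∀ n, e (n + 1) = e n + 1) :
    φ (e 0) = φ' (e 0) ∧ ε (e 0) = ε' (e 0) := by
  let := HasDerivedCategory.standard A
  obtain ⟨v, hv⟩ := exists_v L e he u
  have he0 : e (-1) + 1 = e 0 := by rw [← he]; simp
  have key : ∀ (φ : ∀ i, f i ⟶ g i) (ε : ∀ i, Abelian.Ext (f i) (g (i - 1)) 1), R L u φ ε →
      ∃ (E : A) (ι : g (e 0 - 1) ⟶ E) (p : E ⟶ f (e 0)) (w : ι ≫ p = 0)
        (h : (ShortComplex.mk ι p w).ShortExact), h.extClass = ε (e 0) ∧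
        DerivedCategory.Q.map (jMap (F' := (unroll e he).obj (mkZ f)) (𝟙 (f (e 0)))
            ((congrArg (fun z => _ ≫ z) (unroll_d_zero e he f 0 1)).trans comp_zero)) ≫ v ≫
          DerivedCategory.Q.map (rMap (G' := (unroll e he).obj (mkZ g)) (𝟙 (g (e 0)))
            ((congrArg (fun z => z ≫ _) (unroll_d_zero e he g (-1) 0)).trans zero_comp)) =
          DerivedCategory.Q.map ((CochainComplex.singleFunctor A 0).map (φ (e 0))) ∧
        DerivedCategory.Q.map (jMap (F' := (unroll e he).obj (mkZ f)) (𝟙 (f (e 0)))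
            ((congrArg (fun z => _ ≫ z) (unroll_d_zero e he f 0 1)).trans comp_zero)) ≫ v ≫
          DerivedCategory.Q.map (qMap (G' := (unroll e he).obj (mkZ g))
            (eqToHom (by rw [← he0, add_sub_cancel_right]) : g (e (-1)) ⟶ g (e 0 - 1))
            ((congrArg (fun z => z ≫ _) (unroll_d_zero e he g (-2) (-1))).trans zero_comp)) ≫
          (Functor.commShiftIso DerivedCategory.Q 1).hom.app
            ((CochainComplex.singleFunctor A 0).obj _) =
          - DerivedCategory.triangleOfSESδ (sgl_exact ι p w h) := by
    intro φ ε hu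
    obtain ⟨E, ι, p, w, h, hLu, hε⟩ := R_canon L φ ε u hu
    have ha : (biprod.inl : E (e 0) ⟶ E (e 0) ⊞ g (e 0 + 1 - 1)) ≫
      ((unroll e he).obj (tw ι)).d 0 1 = 0 :=
      (congrArg (fun z => _ ≫ z) (unroll_d e he (tw ι) 0 1 (by simp))).trans (twd_inl ι _ _)
    have hb : (eqToHom (by rw [he0]) ≫ biprod.inr :
        g (e 0 - 1) ⟶ E (e (-1)) ⊞ g (e (-1) + 1 - 1)) ≫ ((unroll e he).obj (tw ι)).d (-1) 0 =
        ι (e 0) ≫ biprod.inl :=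
      (congrArg (fun z => _ ≫ z) (unroll_d e he (tw ι) (-1) 0 (by simp))).trans
        (twd_inr ι _ _ he0)
    have h1 : biprod.inl ≫ ((unroll e he).map (sT ι p w)).f 0 = p (e 0) ≫ 𝟙 (f (e 0)) := by
      rw [Category.comp_id]
      exact biprod.inl_desc _ _
    have h2 : (eqToHom (by rw [he0]) ≫ biprod.inr :
        g (e 0 - 1) ⟶ E (e (-1)) ⊞ g (e (-1) + 1 - 1)) ≫
        ((unroll e he).map (sT ι p w)).f (-1) = 0 := by
      refine (Category.assoc _ _ _).trans ?_
      exact (congrArg (fun z => _ ≫ z) (biprod.inr_desc _ _)).trans comp_zero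
    have h3 : biprod.inl ≫ ((unroll e he).map (mT ι p w φ (fun _ => 𝟙 _))).f 0 ≫ 𝟙 (g (e 0)) =
        p (e 0) ≫ φ (e 0) :=
      (congrArg (fun z => biprod.inl ≫ z) (Category.comp_id _)).trans (biprod.inl_desc _ _)
    have h4 : (eqToHom (by rw [he0]) ≫ biprod.inr :
        g (e 0 - 1) ⟶ E (e (-1)) ⊞ g (e (-1) + 1 - 1)) ≫
        ((unroll e he).map (mT ι p w φ (fun _ => 𝟙 _))).f (-1) ≫
        (eqToHom (by rw [← he0, add_sub_cancel_right]) : g (e (-1)) ⟶ g (e 0 - 1)) = 𝟙 _ := by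
      refine Eq.trans ?_ (mT_cast (g := g) _ _ he0)
      refine (Category.assoc _ _ _).trans ?_
      refine congrArg (fun z => _ ≫ z) ?_
      exact biprod.inr_desc_assoc _ _ _
    refine ⟨E (e 0), ι (e 0), p (e 0), w (e 0), h (e 0), hε _, ?_, ?_⟩
    · exact detect_hom _ _ _ (h (e 0)) (T := (unroll e he).obj (tw ι)) biprod.inl _ ha hb _ _
        _ h1 h2 _ _ _ _ h3 v (hv _ _ _ hLu)
    · exact detect_ext _ _ _ (h (e 0)) (T := (unroll e he).obj (tw ι)) biprod.inl _ ha hb _ _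
        _ h1 h2 _ _ _ h4 v (hv _ _ _ hLu)
  obtain ⟨E, ι, p, w, h, h1, h2, h3⟩ := key φ ε hu
  obtain ⟨E', ι', p', w', h', h1', h2', h3'⟩ := key φ' ε' hu'
  refine ⟨single_inj (h2.symm.trans h2'), ?_⟩
  rw [← h1, ← h1']
  exact extClass_inj _ _ _ _ _ _ h h' (neg_injective (h3.symm.trans h3'))

lemma R_inj {f g : ZMod t → A} (φ φ' : ∀ i, f i ⟶ g i)
    (ε ε' : ∀ i, Abelian.Ext (f i) (g (i - 1)) 1) (u) (hu : R L u φ ε) (hu' : R L u φ' ε') :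
    φ = φ' ∧ ε = ε' := by
  have H : ∀ i k : ZMod t, i + ((0 : ℤ) : ZMod t) = k → φ k = φ' k ∧ ε k = ε' k := by
    rintro i _ rfl
    exact R_inj_aux L φ φ' ε ε' u hu hu' (fun n => i + (n : ZMod t))
      (fun n => by push_cast; ring)
  exact ⟨funext fun i => (H i i (by simp)).1, funext fun i => (H i i (by simp)).2⟩

lemma card_hom [NeZero t] (hered : ∀ X Y : A, Subsingleton (Abelian.Ext X Y 2))
    (f g : ZMod t → A) :
    Nat.card (L.obj (mkZ f) ⟶ L.obj (mkZ g)) =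
      (∏ i, homCard (f i) (g i)) * ∏ i, ext1Card (f (i + 1)) (g i) := by
  choose φ ε hR using fun u => R_surj L hered (f := f) (g := g) u
  have hb : Function.Bijective (fun u => (φ u, ε u)) := by
    constructor
    · intro u u' h
      obtain ⟨h1, h2⟩ := Prod.ext_iff.1 h
      dsimp only at h1 h2
      obtain ⟨v, hv⟩ := R_unique L (φ u) (ε u)
      rw [hv u (hR u), hv u' (by rw [h1, h2]; exact hR u')]
    · rintro ⟨a, b⟩
      obtain ⟨u, hu⟩ := R_exists L a b
      obtain ⟨h1, h2⟩ := R_inj L _ _ _ _ u (hR u) hu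
      exact ⟨u, Prod.ext h1 h2⟩
  rw [Nat.card_eq_of_bijective _ hb, Nat.card_prod, Nat.card_pi, Nat.card_pi]
  congr 1
  rw [← Equiv.prod_comp (Equiv.addRight (1 : ZMod t))]
  refine Finset.prod_congr rfl fun i _ => ?_
  simp [ext1Card]

end


lemma prod_range_zmod {t : ℕ} [NeZero t] (F : ZMod t → ℚ) :
    ∏ i ∈ Finset.range t, F (i : ZMod t) = ∏ i : ZMod t, F i := by
  refine Finset.prod_nbij' (fun i => (i : ZMod t)) ZMod.val (by simp)
    (fun a _ => Finset.mem_range.2 (ZMod.val_lt a))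
    (fun a ha => ZMod.val_cast_of_lt (Finset.mem_range.1 ha))
    (fun a _ => ZMod.natCast_zmod_val a) (fun _ _ => rfl)

lemma combi (n : ℕ) (hn : Even n) (P Q : ℕ → ℚ) (hQ : Q (n + 1) = Q 0) :
    ∏ i ∈ Finset.range (n + 1), (P i * Q (i + 1)) ^ ((-1 : ℤ) ^ i) =
      P 0 * Q 0 * ∏ k ∈ Finset.Icc 1 n, (P k / Q k) ^ ((-1 : ℤ) ^ k) := by
  have h1 : ∀ F : ℕ → ℚ, ∏ k ∈ Finset.Icc 1 n, F k = ∏ k ∈ Finset.range n, F (k + 1) := by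
    intro F
    rw [show Finset.Icc 1 n = Finset.Ico 1 (n + 1) from rfl, Finset.prod_Ico_eq_prod_range]
    simp [add_comm]
  simp only [h1, mul_zpow, Finset.prod_mul_distrib]
  rw [Finset.prod_range_succ' (fun i => P i ^ ((-1 : ℤ) ^ i)),
    Finset.prod_range_succ (fun i => Q (i + 1) ^ ((-1 : ℤ) ^ i)), hQ, hn.neg_one_pow]
  have h2 : ∀ k, (P (k + 1) / Q (k + 1)) ^ ((-1 : ℤ) ^ (k + 1)) =
      P (k + 1) ^ ((-1 : ℤ) ^ (k + 1)) * Q (k + 1) ^ ((-1 : ℤ) ^ k) := by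
    intro k
    rw [div_zpow, div_eq_mul_inv, ← zpow_neg (Q (k + 1)), pow_succ (-1 : ℤ) k]
    simp
  simp only [h2, Finset.prod_mul_distrib, pow_zero, zpow_one]
  ring

theorem alternating_hom_product_formula
    (k : Type) [Field k] [Fintype k]
    (A : Type) [SmallCategory A] [Abelian A] [CategoryTheory.Linear k A]
    [HasExt.{0} A]
    (hfinHom : ∀ X Y : A, Finite (X ⟶ Y))
    (hfinExt : ∀ X Y : A, Finite (Abelian.Ext X Y 1))
    (hered : ∀ X Y : A, Subsingleton (Abelian.Ext X Y 2))
    (t : ℕ) [NeZero t] (ht : Odd t)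
    (E : Type*) [Category E] (L : Ct A t ⥤ E)
    [L.IsLocalization (HomologicalComplex.quasiIso A (pShape t))]
    (f g : ZMod t → A) :
    ∏ i ∈ Finset.range t,
        (Nat.card (L.obj (mkZero (fun j => f (j + (i : ZMod t)))) ⟶
            L.obj (mkZero g)) : ℚ) ^ ((-1 : ℤ) ^ i)
      = ∏ i ∈ Finset.range t,
          ((homCard (f (i : ZMod t)) (g (i : ZMod t)) : ℚ) *
            (ext1Card (f (i : ZMod t)) (g (i : ZMod t)) : ℚ) *
            ∏ j ∈ Finset.Icc 1 (t - 1),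
              (euler (f ((i : ZMod t) + (j : ZMod t))) (g (i : ZMod t))) ^
                ((-1 : ℤ) ^ j)) := by
  have hcard : ∀ i : ℕ, Nat.card (L.obj (mkZero (fun j => f (j + (i : ZMod t)))) ⟶
            L.obj (mkZero g)) = (∏ j, homCard (f (j + (i : ZMod t))) (g j)) *
              ∏ j, ext1Card (f (j + ((i + 1 : ℕ) : ZMod t))) (g j) := by
    intro i
    refine (card_hom L hered (fun j => f (j + (i : ZMod t))) g).trans ?_
    congr 1
    refine Finset.prod_congr rfl fun j _ => ?_
    rw [show j + ((i + 1 : ℕ) : ZMod t) = j + 1 + (i : ZMod t) by push_cast; ring]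
  let P : ℕ → ℚ := fun i => ∏ j : ZMod t, (homCard (f (j + (i : ZMod t))) (g j) : ℚ)
  let Q : ℕ → ℚ := fun i => ∏ j : ZMod t, (ext1Card (f (j + (i : ZMod t))) (g j) : ℚ)
  have hl : ∀ i : ℕ, (Nat.card (L.obj (mkZero (fun j => f (j + (i : ZMod t)))) ⟶
            L.obj (mkZero g)) : ℚ) = P i * Q (i + 1) := by
    intro i
    rw [hcard]
    simp only [P, Q, Nat.cast_mul, Nat.cast_prod]
  simp only [hl]
  rw [prod_range_zmod (fun i => (homCard (f i) (g i) : ℚ) * (ext1Card (f i) (g i) : ℚ) *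
            ∏ j ∈ Finset.Icc 1 (t - 1), (euler (f (i + (j : ZMod t))) (g i)) ^ ((-1 : ℤ) ^ j)),
    Finset.prod_mul_distrib, Finset.prod_mul_distrib, Finset.prod_comm]
  have hr : ∀ j : ℕ, ∏ i : ZMod t, (euler (f (i + (j : ZMod t))) (g i)) ^ ((-1 : ℤ) ^ j) =
      (P j / Q j) ^ ((-1 : ℤ) ^ j) := by
    intro j
    rw [Finset.prod_zpow]
    simp only [P, Q, euler, Finset.prod_div_distrib]
  simp only [hr]
  have hQ : Q (t - 1 + 1) = Q 0 := by
    rw [show t - 1 + 1 = t from Nat.sub_add_cancel ht.pos]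
    simp [Q]
  have hP0 : P 0 = ∏ i : ZMod t, (homCard (f i) (g i) : ℚ) := by simp [P]
  have hQ0 : Q 0 = ∏ i : ZMod t, (ext1Card (f i) (g i) : ℚ) := by simp [Q]
  rw [← hP0, ← hQ0, ← combi (t - 1) (Nat.Odd.sub_odd ht odd_one) P Q hQ,
    show t - 1 + 1 = t from Nat.sub_add_cancel ht.pos]


end GreenDH
end
end
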